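/- arXiv:2107.06582 — 6 statements merged into one kernel-verified Lean document; each statement's English description precedes it below -/
import Mathlib

section
/- For every finite simple graph G and every integer k ≥ 3, the number N_k of rooted directed k-cycles of G satisfies N_k² ≤ m^k. In particular, the number of k-cycle subgraphs of G, which equals N_k/(2k), is at most m^{k/2}. -/
/-- The number of rooted directed `k`-cycles of a graph `G`: pairs `(v, w)` where `w` is a
closed walk of length `k` at `v` that is a cycle. -/
noncomputable def rootedCycleCount {V : Type*} (G : SimpleGraph V) (k : ℕ) : ℕ :=
  Nat.card ((v : V) × {w : G.Walk v v // w.length = k ∧ w.IsCycle})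

open Finset in
theorem aux_mul {V : Type*} [Fintype V] (A B : Matrix V V ℕ) :
    ∑ i, ∑ j, ((A * B) i j) ^ 2 ≤ (∑ i, ∑ j, (A i j) ^ 2) * (∑ i, ∑ j, (B i j) ^ 2) := by
  have h : ∀ i j, ((A * B) i j) ^ 2 ≤ (∑ l, (A i l) ^ 2) * (∑ l, (B l j) ^ 2) := by
    intro i j
    rw [Matrix.mul_apply]
    exact sum_mul_sq_le_sq_mul_sq _ _ _
  calc _ ≤ ∑ i, ∑ j, (∑ l, (A i l) ^ 2) * (∑ l, (B l j) ^ 2) :=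
        sum_le_sum fun i _ => sum_le_sum fun j _ => h i j
    _ = _ := by
        rw [← sum_mul_sum, sum_comm (f := fun j l => (B l j) ^ 2)]

open Finset in
theorem aux_pow {V : Type*} [Fintype V] [DecidableEq V] (A : Matrix V V ℕ) (n : ℕ) :
    ∑ i, ∑ j, ((A ^ (n + 1)) i j) ^ 2 ≤ (∑ i, ∑ j, (A i j) ^ 2) ^ (n + 1) := by
  induction n with
  | zero => simp
  | succ n ih =>
    rw [pow_succ, pow_succ (∑ i, ∑ j, (A i j) ^ 2)]
    exact (aux_mul _ _).trans (Nat.mul_le_mul_right _ ih)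

open Finset in
theorem aux_trace {V : Type*} [Fintype V] (A B : Matrix V V ℕ) :
    (∑ i, (A * B) i i) ^ 2 ≤ (∑ i, ∑ j, (A i j) ^ 2) * (∑ i, ∑ j, (B i j) ^ 2) := by
  have h := sum_mul_sq_le_sq_mul_sq (univ : Finset (V × V)) (fun p => A p.1 p.2)
    (fun p => B p.2 p.1)
  simp only [Fintype.sum_prod_type] at h
  rw [sum_comm (f := fun j l => (B l j) ^ 2)] at h
  simpa only [Matrix.mul_apply] using h

theorem aux_count {V : Type*} [Fintype V] [DecidableEq V] (G : SimpleGraph V)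
    [DecidableRel G.Adj] (k : ℕ) :
    rootedCycleCount G k ≤ ∑ v, (G.adjMatrix ℕ ^ k) v v := by
  have h : ∀ v, (G.adjMatrix ℕ ^ k) v v = Fintype.card {p : G.Walk v v | p.length = k} := by
    intro v
    rw [SimpleGraph.adjMatrix_pow_apply_eq_card_walk]
    rfl
  simp only [h]
  rw [← Fintype.card_sigma, ← Nat.card_eq_fintype_card]
  unfold rootedCycleCount
  refine Nat.card_le_card_of_injective
    (fun x => ⟨x.1, ⟨x.2.1, x.2.2.1⟩⟩) ?_
  rintro ⟨v, w, hw⟩ ⟨v', w', hw'⟩ hh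
  simp only [Sigma.mk.injEq] at hh
  obtain ⟨rfl, hh⟩ := hh
  simp only [heq_eq_eq, Subtype.mk.injEq] at hh
  subst hh
  rfl

theorem aux_main {V : Type*} [Fintype V] (G : SimpleGraph V)
    [DecidableRel G.Adj] (k : ℕ) (hk : 3 ≤ k) :
    rootedCycleCount G k ^ 2 ≤ (∑ v : V, G.degree v) ^ k := by
  classical
  have hm : ∑ v : V, G.degree v = ∑ i, ∑ j, (G.adjMatrix ℕ i j) ^ 2 := by
    refine Finset.sum_congr rfl fun i _ => ?_
    simp [SimpleGraph.adjMatrix_apply, ← SimpleGraph.card_neighborFinset_eq_degree,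
      SimpleGraph.neighborFinset_eq_filter]
  obtain ⟨n, rfl⟩ : ∃ n, k = n + 1 + 1 := ⟨k - 2, by omega⟩
  rw [hm]
  refine (Nat.pow_le_pow_left (aux_count G _) 2).trans ?_
  rw [pow_succ, pow_succ (∑ i, ∑ j, (G.adjMatrix ℕ i j) ^ 2)]
  exact (aux_trace _ _).trans (Nat.mul_le_mul_right _ (aux_pow _ n))

/-- For every finite simple graph `G` and integer `k ≥ 3`, the number `N_k`
of rooted directed `k`-cycles satisfies `N_k² ≤ m^k`, where `m = Σ_v d(v)`; in particular the
number of `k`-cycle subgraphs, which equals `N_k/(2k)`, is at most `m^(k/2)`. -/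
theorem rootedCycleCount_sq_le {V : Type*} [Fintype V] (G : SimpleGraph V)
    [DecidableRel G.Adj] (k : ℕ) (hk : 3 ≤ k) :
    rootedCycleCount G k ^ 2 ≤ (∑ v : V, G.degree v) ^ k ∧
      (rootedCycleCount G k : ℝ) / (2 * k) ≤
        ((∑ v : V, G.degree v : ℕ) : ℝ) ^ ((k : ℝ) / 2) := by
  have h := aux_main G k hk
  refine ⟨h, ?_⟩
  generalize rootedCycleCount G k = N at *
  generalize (∑ v : V, G.degree v) = m at *
  have hk' : (3 : ℝ) ≤ k := by exact_mod_cast hk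
  have h' : (N : ℝ) ^ 2 ≤ (m : ℝ) ^ k := by exact_mod_cast h
  have h1 : (N : ℝ) / (2 * k) ≤ N := div_le_self (by positivity) (by linarith)
  refine h1.trans ?_
  refine (pow_le_pow_iff_left₀ (by positivity) (by positivity) two_ne_zero).1 ?_
  rw [← Real.rpow_natCast ((m : ℝ) ^ ((k : ℝ) / 2)) 2, ← Real.rpow_mul (by positivity)]
  have : (k : ℝ) / 2 * ((2 : ℕ) : ℝ) = k := by push_cast; ring
  rw [this, Real.rpow_natCast]
  exact h'
end

section
/- Let k ≥ 3 be an odd integer and r ≥ 1 an integer. The number of rooted directed k-cycles of the cyclic blow-up C_k[r] equals exactly 2k · r^k; equivalently, C_k[r] contains exactly r^k k-cycle subgraphs. -/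
/-- The cyclic blow-up `C_k[r]`: the simple graph on `{0,…,k−1} × {0,…,r−1}` in which `(i,a)`
and `(j,b)` are adjacent iff `j ≡ i+1 (mod k)` or `j ≡ i−1 (mod k)`. -/
def cyclicBlowup (k r : ℕ) : SimpleGraph (ZMod k × Fin r) :=
  SimpleGraph.fromRel (fun x y => y.1 = x.1 + 1)

theorem cyclicBlowup_adj_iff (k r : ℕ) (hk : 3 ≤ k) (x y : ZMod k × Fin r) :
    (cyclicBlowup k r).Adj x y ↔ (y.1 = x.1 + 1 ∨ x.1 = y.1 + 1) := by
  have : Fact (1 < k) := ⟨by omega⟩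
  unfold cyclicBlowup
  rw [SimpleGraph.fromRel_adj]
  constructor
  · exact fun h => h.2
  · intro h
    refine ⟨?_, h⟩
    rintro rfl
    simp at h

/-- A sequence of consecutively adjacent vertices gives a walk. -/
theorem exists_walk_of_seq {V : Type*} (G : SimpleGraph V) (n : ℕ) :
    ∀ (f : ℕ → V), (∀ i, i < n → G.Adj (f i) (f (i + 1))) →
      ∃ w : G.Walk (f 0) (f n), w.length = n ∧ ∀ i, i ≤ n → w.getVert i = f i := by
  induction n with
  | zero =>
    intro f _
    refine ⟨SimpleGraph.Walk.nil, rfl, ?_⟩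
    intro i hi
    obtain rfl : i = 0 := by omega
    simp
  | succ n ih =>
    intro f hf
    obtain ⟨w, hw, hv⟩ := ih (fun i => f (i + 1)) (fun i hi => hf (i + 1) (by omega))
    refine ⟨SimpleGraph.Walk.cons (hf 0 (by omega)) w, by simp [hw], ?_⟩
    intro i hi
    cases i with
    | zero => simp
    | succ i =>
      rw [SimpleGraph.Walk.getVert_cons_succ]
      exact hv i (by omega)

/-- A closed `±1` sequence of odd length `k` in `ZMod k` is monotone. -/
theorem closed_seq_monotone (k : ℕ) (hodd : Odd k) (x : ℕ → ZMod k)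
    (hstep : ∀ i, i < k → (x (i + 1) = x i + 1 ∨ x i = x (i + 1) + 1)) (hclosed : x k = x 0) :
    (∀ i, i < k → x (i + 1) = x i + 1) ∨ (∀ i, i < k → x i = x (i + 1) + 1) := by
  classical
  have key : ∀ n, n ≤ k → x n + n =
      x 0 + 2 * (((Finset.range n).filter (fun i => x (i + 1) = x i + 1)).card : ℕ) := by
    intro n
    induction n with
    | zero => intro _; simp
    | succ n ih =>
      intro hn
      have h := ih (by omega)
      rw [Finset.range_add_one, Finset.filter_insert]
      split_ifs with hP
      · rw [Finset.card_insert_of_notMem (by simp)]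
        push_cast
        rw [hP]
        linear_combination h
      · have h2 := (hstep n (by omega)).resolve_left hP
        push_cast
        linear_combination h - h2
  have hk := key k le_rfl
  rw [hclosed] at hk
  have hd : k ∣ 2 * ((Finset.range k).filter (fun i => x (i + 1) = x i + 1)).card := by
    rw [← ZMod.natCast_eq_zero_iff]
    push_cast
    have := ZMod.natCast_self k
    linear_combination this - hk
  have hd' := (Nat.Coprime.dvd_mul_left (Nat.Coprime.symm (Nat.coprime_two_left.mpr hodd))).mp hd
  have hle := Finset.card_filter_le (Finset.range k) (fun i => x (i + 1) = x i + 1)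
  rw [Finset.card_range] at hle
  rcases Nat.eq_zero_or_pos
    ((Finset.range k).filter (fun i => x (i + 1) = x i + 1)).card with h0 | hpos
  · right
    intro i hi
    rw [Finset.card_eq_zero, Finset.filter_eq_empty_iff] at h0
    exact (hstep i hi).resolve_left (h0 (Finset.mem_range.mpr hi))
  · left
    have heq := le_antisymm hle (Nat.le_of_dvd hpos hd')
    intro i hi
    have := (Finset.card_filter_eq_iff (s := Finset.range k)
      (p := fun i => x (i + 1) = x i + 1)).mp (by rw [heq, Finset.card_range])
    exact this i (Finset.mem_range.mpr hi)

theorem cyclicBlowup_one_ne (k : ℕ) (hk : 3 ≤ k) (s : ZMod k) : ¬ s + (-1) = s + 1 := by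
  intro h
  have h2 : ((2 : ℕ) : ZMod k) = 0 := by push_cast; linear_combination -h
  rw [ZMod.natCast_eq_zero_iff] at h2
  have := Nat.le_of_dvd (by omega) h2
  omega

open Classical in
/-- The direction of a closed walk. -/
theorem closed_walk_fst (k r : ℕ) (hodd : Odd k) (hk : 3 ≤ k) (v : ZMod k × Fin r)
    (w : (cyclicBlowup k r).Walk v v) (hw : w.length = k) (i : ℕ) (hi : i ≤ k) :
    (w.getVert i).1 = v.1 + (if (w.getVert 1).1 = v.1 + 1 then 1 else -1) * i := by
  have hend : w.getVert k = v := w.getVert_of_length_le hw.le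
  have hm := closed_seq_monotone k hodd (fun i => (w.getVert i).1)
    (fun i hi => (cyclicBlowup_adj_iff k r hk _ _).mp (w.adj_getVert_succ (by omega)))
    (by simp [hend])
  rcases hm with hm | hm
  · have h1 := hm 0 (by omega)
    simp only [SimpleGraph.Walk.getVert_zero, zero_add] at h1
    rw [if_pos h1]
    induction i with
    | zero => simp
    | succ i ih =>
      rw [hm i (by omega), ih (by omega)]; push_cast; ring
  · have h1 := hm 0 (by omega)
    simp only [SimpleGraph.Walk.getVert_zero, zero_add] at h1
    have h2 : (w.getVert 1).1 = v.1 + (-1) := by linear_combination -h1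
    rw [if_neg (by rw [h2]; exact cyclicBlowup_one_ne k hk _)]
    clear h1 h2
    induction i with
    | zero => simp
    | succ i ih =>
      have := hm i (by omega)
      have h3 := ih (by omega)
      push_cast
      linear_combination h3 - this

open Classical in
/-- Code of a rooted directed cycle: direction, starting class, representatives. -/
noncomputable def cycleCode (k r : ℕ) :
    ((v : ZMod k × Fin r) × {w : (cyclicBlowup k r).Walk v v // w.length = k ∧ w.IsCycle}) →
      Bool × ZMod k × (Fin k → Fin r) :=
  fun p => (decide ((p.2.1.getVert 1).1 = p.1.1 + 1), p.1.1, fun i => (p.2.1.getVert i).2)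

theorem cycleCode_injective (k r : ℕ) (hodd : Odd k) (hk : 3 ≤ k) :
    Function.Injective (cycleCode k r) := by
  classical
  rintro ⟨v, w, hw, hc⟩ ⟨v', w', hw', hc'⟩ h
  simp only [cycleCode, Prod.mk.injEq, decide_eq_decide] at h
  obtain ⟨h1, h2, h3⟩ := h
  have hvert : ∀ i, i < k → w.getVert i = w'.getVert i := by
    intro i hi
    refine Prod.ext ?_ (congrFun h3 ⟨i, hi⟩)
    rw [closed_walk_fst k r hodd hk v w hw i hi.le, closed_walk_fst k r hodd hk v' w' hw' i hi.le]
    simp only [h1]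
    rw [h2]
  have hv : v = v' := by simpa using hvert 0 (by omega)
  subst hv
  have hww : w = w' := by
    apply SimpleGraph.Walk.ext_getVert_le_length (by rw [hw, hw'])
    intro i hi
    rcases Nat.lt_or_ge i k with h | h
    · exact hvert i h
    · rw [w.getVert_of_length_le (by omega), w'.getVert_of_length_le (by omega)]
  subst hww
  rfl

theorem cycleCode_surjective (k r : ℕ) (hk : 3 ≤ k) :
    Function.Surjective (cycleCode k r) := by
  classical
  rintro ⟨b, s, a⟩
  have hk0 : 0 < k := by omega
  have : NeZero k := ⟨by omega⟩
  obtain ⟨σ, hσ⟩ : ∃ σ : ZMod k, σ = if b then 1 else -1 := ⟨_, rfl⟩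
  have hσ' : σ = 1 ∨ σ = -1 := by cases b <;> simp [hσ]
  obtain ⟨f, hf⟩ : ∃ f : ℕ → ZMod k × Fin r,
      f = fun i : ℕ => (s + σ * (i : ZMod k), a ⟨i % k, Nat.mod_lt _ hk0⟩) := ⟨_, rfl⟩
  have hf0k : f k = f 0 := by simp [hf]
  have hadj : ∀ i, i < k → (cyclicBlowup k r).Adj (f i) (f (i + 1)) := by
    intro i _
    rw [cyclicBlowup_adj_iff k r hk]
    rcases hσ' with h | h
    · left; simp only [hf, h]; push_cast; ring
    · right; simp only [hf, h]; push_cast; ring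
  obtain ⟨w0, hw0, hv0⟩ := exists_walk_of_seq _ k f hadj
  obtain ⟨w, hw, hv⟩ : ∃ w : (cyclicBlowup k r).Walk (f 0) (f 0),
      w.length = k ∧ ∀ i, i ≤ k → w.getVert i = f i :=
    ⟨w0.copy rfl hf0k, by simp [hw0], fun i hi => by simpa using hv0 i hi⟩
  have hinj : ∀ i j, i < k → j < k → f (i + 1) = f (j + 1) → i = j := by
    intro i j hi hj h
    have h1 := congrArg Prod.fst h
    simp only [hf] at h1
    have h2 : (i : ZMod k) = j := by
      push_cast at h1
      rcases hσ' with h | h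
      · rw [h] at h1; linear_combination h1
      · rw [h] at h1; linear_combination -h1
    rw [ZMod.natCast_eq_natCast_iff'] at h2
    rwa [Nat.mod_eq_of_lt hi, Nat.mod_eq_of_lt hj] at h2
  have hnn : ¬ w.Nil := by
    intro h
    have := SimpleGraph.Walk.nil_iff_length_eq.mp h
    omega
  have hlen : w.tail.length + 1 = k := by
    rw [SimpleGraph.Walk.length_tail_add_one hnn, hw]
  have hcyc : w.IsCycle := by
    rw [SimpleGraph.Walk.isCycle_iff_isPath_tail_and_le_length]
    refine ⟨?_, by omega⟩
    rw [← SimpleGraph.Walk.IsPath.getVert_injOn_iff]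
    intro i hi j hj h
    simp only [Set.mem_setOf_eq] at hi hj
    rw [SimpleGraph.Walk.getVert_tail, SimpleGraph.Walk.getVert_tail,
      hv _ (by omega), hv _ (by omega)] at h
    exact hinj i j (by omega) (by omega) h
  refine ⟨⟨f 0, w, hw, hcyc⟩, ?_⟩
  simp only [cycleCode, Prod.mk.injEq]
  refine ⟨?_, by simp [hf], ?_⟩
  · rw [hv 1 (by omega)]
    have := cyclicBlowup_one_ne k hk s
    cases b
    · simp only [hf, hσ]
      simpa using this
    · simp [hf, hσ]
  · funext i
    rw [hv i i.2.le]
    simp only [hf]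
    congr 1
    exact Fin.ext (Nat.mod_eq_of_lt i.2)

/-- For odd `k ≥ 3` and `r ≥ 1`, the number of rooted directed `k`-cycles of
the cyclic blow-up `C_k[r]` equals exactly `2k · r^k`; equivalently, `C_k[r]` contains exactly
`r^k` `k`-cycle subgraphs. -/
theorem cyclicBlowup_rootedCycleCount (k r : ℕ) (hodd : Odd k) (hk : 3 ≤ k) (hr : 1 ≤ r) :
    rootedCycleCount (cyclicBlowup k r) k = 2 * k * r ^ k := by
  unfold rootedCycleCount
  rw [Nat.card_congr (Equiv.ofBijective (cycleCode k r)
    ⟨cycleCode_injective k r hodd hk, cycleCode_surjective k r hk⟩)]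
  simp [Nat.card_prod, Nat.card_fun, mul_assoc]
end

section
/- Let k ≥ 3 be an odd integer, r ≥ 1 an integer, and let F be a set of t pairs of vertices of the form ((0,a),(1,b)) with a,b ∈ {0,…,r−1}. Let G_F be the simple graph on vertex set {0,…,k−1} × {0,…,r−1} in which, for j ≡ i+1 (mod k), the vertices (i,a) and (j,b) are adjacent if and only if either (i,j) ≠ (0,1), or (i,j) = (0,1) and ((0,a),(1,b)) ∈ F (and there are no other adjacencies). Then the number of rooted directed k-cycles of G_F equals exactly 2k · t · r^{k−2}. Moreover, if F = ∅ then G_F is bipartite and contains no closed walk of odd length. -/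
/-- The gadget graph `G_F` on `{0,…,k−1} × {0,…,r−1}`: for `j ≡ i+1 (mod k)`, the vertices
`(i,a)` and `(j,b)` are adjacent iff either `(i,j) ≠ (0,1)`, or `(i,j) = (0,1)` and
`(a,b) ∈ F`; there are no other adjacencies. -/
def gadgetGraph (k r : ℕ) (F : Finset (Fin r × Fin r)) : SimpleGraph (ZMod k × Fin r) :=
  SimpleGraph.fromRel (fun x y => y.1 = x.1 + 1 ∧ (x.1 = 0 → (x.2, y.2) ∈ F))

theorem gg_adj (k r : ℕ) (hk : 3 ≤ k) (F : Finset (Fin r × Fin r)) (x y : ZMod k × Fin r) :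
    (gadgetGraph k r F).Adj x y ↔
      (y.1 = x.1 + 1 ∧ (x.1 = 0 → (x.2, y.2) ∈ F)) ∨
      (x.1 = y.1 + 1 ∧ (y.1 = 0 → (y.2, x.2) ∈ F)) := by
  haveI : Fact (1 < k) := ⟨by omega⟩
  unfold gadgetGraph
  rw [SimpleGraph.fromRel_adj]
  constructor
  · exact fun h => h.2
  · intro h
    refine ⟨?_, h⟩
    rintro rfl
    rcases h with h | h <;> simpa using h.1

theorem exists_walk_of_fun {V : Type*} (G : SimpleGraph V) (n : ℕ) :
    ∀ f : ℕ → V, (∀ j < n, G.Adj (f j) (f (j + 1))) →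
      ∃ w : G.Walk (f 0) (f n), w.length = n ∧ ∀ j ≤ n, w.getVert j = f j := by
  induction n with
  | zero =>
    intro f _
    refine ⟨.nil, rfl, ?_⟩
    intro j hj
    obtain rfl : j = 0 := by omega
    rfl
  | succ n ih =>
    intro f hf
    obtain ⟨w, hw, hg⟩ := ih (fun j => f (j + 1)) (fun j hj => hf (j + 1) (by omega))
    refine ⟨.cons (hf 0 (by omega)) w, by simp [hw], ?_⟩
    intro j hj
    cases j with
    | zero => simp
    | succ j =>
      rw [SimpleGraph.Walk.getVert_cons_succ]
      exact hg j (by omega)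

theorem sigma_walk_ext {V : Type*} (G : SimpleGraph V) (k : ℕ)
    (p q : (v : V) × {w : G.Walk v v // w.length = k ∧ w.IsCycle})
    (h : ∀ j ≤ k, p.2.1.getVert j = q.2.1.getVert j) : p = q := by
  obtain ⟨u, p, hp, hp'⟩ := p
  obtain ⟨v, q, hq, hq'⟩ := q
  have h0 := h 0 (by omega)
  simp only [SimpleGraph.Walk.getVert_zero] at h0
  subst h0
  have : p = q := by
    apply SimpleGraph.Walk.ext_getVert_le_length (by omega)
    intro j hj
    exact h j (by omega)
  subst this
  rfl

def gsgn (k : ℕ) (b : Bool) : ZMod k := if b then 1 else -1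

theorem gsgn_mul_self (k : ℕ) (b : Bool) : gsgn k b * gsgn k b = 1 := by
  cases b <;> simp [gsgn]

theorem natCast_inj_lt {k a b : ℕ} (ha : a < k) (hb : b < k) (h : (a : ZMod k) = b) : a = b := by
  rw [ZMod.natCast_eq_natCast_iff'] at h
  rwa [Nat.mod_eq_of_lt ha, Nat.mod_eq_of_lt hb] at h

theorem exists_cycle (k r : ℕ) (hk : 3 ≤ k) (F : Finset (Fin r × Fin r))
    (b : Bool) (i : ZMod k) (g : ZMod k → Fin r) (hg : (g 0, g 1) ∈ F) :
    ∃ p : (v : ZMod k × Fin r) × {w : (gadgetGraph k r F).Walk v v // w.length = k ∧ w.IsCycle},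
      ∀ j ≤ k, p.2.1.getVert j = (i + gsgn k b * j, g (i + gsgn k b * j)) := by
  obtain ⟨w, hw, hj⟩ := exists_walk_of_fun (gadgetGraph k r F) k
    (fun j : ℕ => (i + gsgn k b * j, g (i + gsgn k b * j))) (by
      intro j hj
      rw [gg_adj k r hk]
      cases b
      · right
        simp only [gsgn]
        refine ⟨by push_cast; simp; ring, ?_⟩
        intro h0
        rw [h0]
        have : i + (if false = true then 1 else -1) * (j : ZMod k) = 1 := by
          simp at h0 ⊢
          linear_combination h0
        rw [this]; exact hg
      · left
        simp only [gsgn]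
        refine ⟨by push_cast; simp; ring, ?_⟩
        intro h0
        rw [h0]
        have : i + (if True then 1 else -1) * ((j + 1 : ℕ) : ZMod k) = 1 := by
          simp at h0 ⊢
          linear_combination h0
        rw [this]; exact hg)
  have hc : ((i + gsgn k b * (k : ℕ), g (i + gsgn k b * (k : ℕ))) : ZMod k × Fin r) =
    (i + gsgn k b * (0 : ℕ), g (i + gsgn k b * (0 : ℕ))) := by simp
  refine ⟨⟨_, w.copy rfl hc, by simpa using hw, ?_⟩, ?_⟩
  · rw [SimpleGraph.Walk.isCycle_iff_isPath_tail_and_le_length]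
    refine ⟨?_, by simpa [hw] using hk⟩
    rw [← SimpleGraph.Walk.IsPath.getVert_injOn_iff]
    intro a ha c hc' hac
    simp only [SimpleGraph.Walk.length_tail, SimpleGraph.Walk.length_copy, hw, Set.mem_setOf_eq] at ha hc'
    simp only [SimpleGraph.Walk.getVert_tail, SimpleGraph.Walk.getVert_copy] at hac
    rw [hj _ (by omega), hj _ (by omega)] at hac
    have h1 := congrArg Prod.fst hac
    simp only [add_right_inj] at h1
    have h2 : (a : ZMod k) = c := by
      push_cast at h1
      linear_combination gsgn k b * h1 - ((a : ZMod k) - c) * gsgn_mul_self k b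
    exact natCast_inj_lt (by omega) (by omega) h2
  · intro j hjk
    simp only [SimpleGraph.Walk.getVert_copy]
    exact hj j hjk

theorem walk_direction (k r : ℕ) (hodd : Odd k) (hk : 3 ≤ k) (p : ℕ → ZMod k)
    (hp : p k = p 0)
    (hs : ∀ j < k, p (j + 1) = p j + 1 ∨ p j = p (j + 1) + 1) :
    ∃ b : Bool, ∀ j ≤ k, p j = p 0 + gsgn k b * j := by
  classical
  have key : ∀ n ≤ k, p n = p 0 + 2 *
      (((Finset.range n).filter (fun j => p (j + 1) = p j + 1)).card : ZMod k) - n := by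
    intro n
    induction n with
    | zero => simp
    | succ n ih =>
      intro hn
      have ih := ih (by omega)
      rw [Finset.range_add_one, Finset.filter_insert]
      split_ifs with h
      · rw [Finset.card_insert_of_notMem (by simp), h, ih]
        push_cast; ring
      · have := (hs n (by omega)).resolve_left h
        push_cast
        linear_combination ih - this
  set m := ((Finset.range k).filter (fun j => p (j + 1) = p j + 1)).card with hm
  have hmk : m ≤ k := by
    simpa using Finset.card_filter_le (Finset.range k) (fun j => p (j + 1) = p j + 1)
  have h1 := key k le_rfl
  rw [hp, ← hm] at h1
  have h2 : ((2 * m : ℕ) : ZMod k) = 0 := by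
    push_cast
    rw [ZMod.natCast_self] at h1
    linear_combination -h1
  rw [ZMod.natCast_eq_zero_iff] at h2
  have h3 : k ∣ m := (Nat.Coprime.dvd_of_dvd_mul_left (Nat.coprime_two_right.mpr hodd) h2)
  have h4 : m = 0 ∨ m = k := by
    rcases Nat.eq_zero_or_pos m with h | h
    · exact Or.inl h
    · exact Or.inr (le_antisymm hmk (Nat.le_of_dvd h h3))
  have step : ∃ b : Bool, ∀ j < k, p (j + 1) = p j + gsgn k b := by
    rcases h4 with h4 | h4
    · refine ⟨false, fun j hj => ?_⟩
      rw [hm, Finset.card_eq_zero, Finset.filter_eq_empty_iff] at h4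
      have := (hs j hj).resolve_left (h4 (by simpa using hj))
      simp only [gsgn]
      rw [this]; simp
    · refine ⟨true, fun j hj => ?_⟩
      have h5 := (Finset.card_filter_eq_iff (s := Finset.range k)
        (p := fun j => p (j + 1) = p j + 1)).1 (by rw [← hm, h4]; simp)
      simpa [gsgn] using h5 j (by simpa using hj)
  obtain ⟨b, hb⟩ := step
  refine ⟨b, fun j => ?_⟩
  induction j with
  | zero => simp
  | succ j ih =>
    intro hj
    rw [hb j (by omega), ih (by omega)]
    push_cast; ring

theorem card_fun (m r : ℕ) (F : Finset (Fin r × Fin r)) :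
    Nat.card {g : Fin (m + 2) → Fin r // (g 0, g 1) ∈ F} = F.card * r ^ m := by
  have e : {g : Fin (m + 2) → Fin r // (g 0, g 1) ∈ F} ≃ F × (Fin m → Fin r) :=
    { toFun := fun g => (⟨(g.1 0, g.1 1), g.2⟩, fun i => g.1 i.succ.succ)
      invFun := fun q => ⟨Fin.cons q.1.1.1 (Fin.cons q.1.1.2 q.2), by
        have : (1 : Fin (m + 2)) = Fin.succ 0 := rfl
        rw [this, Fin.cons_succ]
        simp⟩
      left_inv := by
        rintro ⟨g, hg⟩
        apply Subtype.ext
        funext i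
        refine Fin.cases ?_ (fun i => ?_) i
        · simp
        · refine Fin.cases ?_ (fun i => ?_) i
          · simp
          · simp
      right_inv := by
        rintro ⟨⟨⟨a, b⟩, h⟩, f⟩
        have : (1 : Fin (m + 2)) = Fin.succ 0 := rfl
        simp only [this, Fin.cons_succ, Fin.cons_zero] }
  rw [Nat.card_congr e]
  simp

theorem count_main (k r : ℕ) (hodd : Odd k) (hk : 3 ≤ k) (F : Finset (Fin r × Fin r)) :
    rootedCycleCount (gadgetGraph k r F) k = 2 * k * F.card * r ^ (k - 2) := by
  haveI : NeZero k := ⟨by omega⟩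
  have hcard : Nat.card {g : ZMod k → Fin r // (g 0, g 1) ∈ F} = F.card * r ^ (k - 2) := by
    obtain ⟨m, rfl⟩ : ∃ m, k = m + 2 := ⟨k - 2, by omega⟩
    exact card_fun m r F
  choose Φ hΦ using fun q : Bool × ZMod k × {g : ZMod k → Fin r // (g 0, g 1) ∈ F} =>
    exists_cycle k r hk F q.1 q.2.1 q.2.2.1 q.2.2.2
  have hbij : Function.Bijective Φ := by
    constructor
    · rintro ⟨b, i, g, hg⟩ ⟨b', i', g', hg'⟩ h
      have H : ∀ j ≤ k, ((i + gsgn k b * j, g (i + gsgn k b * j)) : ZMod k × Fin r) =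
          (i' + gsgn k b' * j, g' (i' + gsgn k b' * j)) := by
        intro j hj
        rw [← hΦ ⟨b, i, g, hg⟩ j hj, ← hΦ ⟨b', i', g', hg'⟩ j hj, h]
      have hi : i = i' := by simpa using congrArg Prod.fst (H 0 (by omega))
      subst hi
      have hs : gsgn k b = gsgn k b' := by simpa using congrArg Prod.fst (H 1 (by omega))
      have h2 : (1 : ZMod k) ≠ -1 := by
        intro h
        have : ((2 : ℕ) : ZMod k) = (0 : ℕ) := by
          push_cast; linear_combination h
        have := natCast_inj_lt (by omega) (by omega) this
        omega
      have hb : b = b' := by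
        cases b <;> cases b' <;> simp_all [gsgn]
      subst hb
      have hgg : g = g' := by
        funext x
        have := congrArg Prod.snd (H (gsgn k b * (x - i)).val (ZMod.val_lt _).le)
        simp only [ZMod.natCast_zmod_val] at this
        have hx : i + gsgn k b * (gsgn k b * (x - i)) = x := by
          linear_combination (x - i) * gsgn_mul_self k b
        rwa [hx] at this
      subst hgg
      rfl
    · rintro ⟨v, w, hw, hcyc⟩
      have hadj : ∀ j < k, _ := fun j hj =>
        (gg_adj k r hk F _ _).1 (w.adj_getVert_succ (i := j) (by omega))
      have hkk : w.getVert k = w.getVert 0 := by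
        rw [SimpleGraph.Walk.getVert_zero, SimpleGraph.Walk.getVert_of_length_le w hw.le]
      obtain ⟨b, hb⟩ := walk_direction k r hodd hk (fun j => (w.getVert j).1)
        (by simp only [hkk])
        (fun j hj => (hadj j hj).imp (fun h => h.1) (fun h => h.1))
      set i := (w.getVert 0).1 with hi
      have hg : ∀ j ≤ k, w.getVert j = (i + gsgn k b * j,
          (w.getVert (gsgn k b * ((i + gsgn k b * j) - i)).val).2) := by
        intro j hj
        have e : gsgn k b * ((i + gsgn k b * j) - i) = (j : ZMod k) := by
          linear_combination (j : ZMod k) * gsgn_mul_self k b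
        rw [e, ZMod.val_natCast]
        refine Prod.ext (hb j hj) ?_
        rcases hj.lt_or_eq with h | h
        · rw [Nat.mod_eq_of_lt h]
        · rw [h, Nat.mod_self, hkk]
      set g : ZMod k → Fin r := fun x => (w.getVert (gsgn k b * (x - i)).val).2 with hgdef
      have hg2 : ∀ j ≤ k, w.getVert j = (i + gsgn k b * j, g (i + gsgn k b * j)) := hg
      have hF : (g 0, g 1) ∈ F := by
        cases b
        · have hlt : ((i - 1).val) < k := ZMod.val_lt _
          have h1 : i + gsgn k false * (((i - 1).val : ℕ) : ZMod k) = 1 := by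
            simp [gsgn]
          have h2 : i + gsgn k false * (((i - 1).val + 1 : ℕ) : ZMod k) = 0 := by
            simp [gsgn]
          have := hadj _ hlt
          rw [hg2 _ hlt.le, hg2 _ hlt, h1, h2] at this
          rcases this with h | h
          · exfalso
            have h := h.1
            simp only at h
            have : ((2 : ℕ) : ZMod k) = (0 : ℕ) := by
              push_cast; linear_combination -h
            have := natCast_inj_lt (by omega) (by omega) this
            omega
          · exact h.2 rfl
        · have hlt : ((-i).val) < k := ZMod.val_lt _
          have h1 : i + gsgn k true * (((-i).val : ℕ) : ZMod k) = 0 := by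
            simp [gsgn]
          have h2 : i + gsgn k true * (((-i).val + 1 : ℕ) : ZMod k) = 1 := by
            simp [gsgn]
          have := hadj _ hlt
          rw [hg2 _ hlt.le, hg2 _ hlt, h1, h2] at this
          rcases this with h | h
          · exact h.2 rfl
          · exfalso
            have h := h.1
            simp only at h
            have : ((2 : ℕ) : ZMod k) = (0 : ℕ) := by
              push_cast; linear_combination -h
            have := natCast_inj_lt (by omega) (by omega) this
            omega
      refine ⟨⟨b, i, g, hF⟩, sigma_walk_ext _ _ _ _ fun j hj => ?_⟩
      rw [hΦ _ j hj]
      exact (hg2 j hj).symm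
  unfold rootedCycleCount
  rw [← Nat.card_eq_of_bijective Φ hbij, Nat.card_prod, Nat.card_prod, hcard]
  simp
  ring

theorem empty_colorable (k r : ℕ) (hk : 3 ≤ k) : (gadgetGraph k r ∅).Colorable 2 := by
  haveI : NeZero k := ⟨by omega⟩
  haveI : Fact (1 < k) := ⟨by omega⟩
  have aux : ∀ x : ZMod k, x ≠ 0 → x.val = (x - 1).val + 1 := by
    intro x hx
    have h1 : 1 ≤ x.val := Nat.one_le_iff_ne_zero.2 (by simpa using hx)
    rw [ZMod.val_sub (by rw [ZMod.val_one]; exact h1), ZMod.val_one]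
    omega
  have aux2 : ∀ x y : ZMod k × Fin r,
      (y.1 = x.1 + 1 ∧ (x.1 = 0 → (x.2, y.2) ∈ (∅ : Finset (Fin r × Fin r)))) →
      (y.1 - 1).val = (x.1 - 1).val + 1 := by
    rintro x y ⟨h1, h2⟩
    rw [h1, add_sub_cancel_right]
    apply aux
    intro h
    simpa using h2 h
  refine ⟨SimpleGraph.Coloring.mk
    (fun x => (⟨(x.1 - 1).val % 2, Nat.mod_lt _ (by omega)⟩ : Fin 2)) ?_⟩
  intro x y h
  rw [gg_adj k r hk] at h
  intro he
  have he := congrArg Fin.val he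
  simp only at he
  rcases h with h | h
  · have := aux2 _ _ h; omega
  · have := aux2 _ _ h; omega

/-- For odd `k ≥ 3`, `r ≥ 1` and a set `F` of `t` pairs
`((0,a),(1,b))`, the number of rooted directed `k`-cycles of `G_F` equals exactly
`2k · t · r^(k−2)`; moreover, if `F = ∅` then `G_F` is bipartite (2-colorable) and contains no
closed walk of odd length. -/
theorem gadgetGraph_rootedCycleCount (k r : ℕ) (hodd : Odd k) (hk : 3 ≤ k) (hr : 1 ≤ r)
    (F : Finset (Fin r × Fin r)) :
    rootedCycleCount (gadgetGraph k r F) k = 2 * k * F.card * r ^ (k - 2) ∧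
      (F = ∅ →
        (gadgetGraph k r F).Colorable 2 ∧
          ∀ (v : ZMod k × Fin r) (w : (gadgetGraph k r F).Walk v v), ¬ Odd w.length) := by
  refine ⟨count_main k r hodd hk F, ?_⟩
  rintro rfl
  have hc := empty_colorable k r hk
  refine ⟨hc, fun v w => ?_⟩
  rw [Nat.not_odd_iff_even]
  exact SimpleGraph.two_colorable_iff_forall_loop_even.1 hc v w
end

section
/- Every finite simple graph H with no isolated vertices admits a fractional edge cover x* of minimum cost ρ(H) (in particular the minimum cost is attained), together with a collection of pairwise vertex-disjoint subgraphs of H, each of which is an odd cycle or a star, whose vertex sets cover all vertices of H, such that x*(e) = 1/2 for every edge e of one of the odd cycles, x*(e) = 1 for every edge e of one of the stars, and x*(e) = 0 for every other edge of H. -/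
open SimpleGraph

/-- A graph is an odd cycle if it is isomorphic to the cycle graph on an odd number
`k ≥ 3` of vertices. -/
def IsOddCycleGraph {W : Type*} (G : SimpleGraph W) : Prop :=
  ∃ k : ℕ, Odd k ∧ 3 ≤ k ∧ Nonempty (G ≃g cycleGraph k)

/-- A graph is a `p`-star (`p ≥ 1`) if it is isomorphic to the star `K_{1,p}`. -/
def IsStarGraph {W : Type*} (G : SimpleGraph W) : Prop :=
  ∃ p : ℕ, 1 ≤ p ∧ Nonempty (G ≃g completeBipartiteGraph (Fin 1) (Fin p))

/-- A valid decomposition of `H`: a collection of pairwise vertex-disjoint subgraphs of `H`,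
each an odd cycle or a star, whose vertex sets cover all vertices of `H`. -/
structure ValidDecomposition {V : Type*} (H : SimpleGraph V) where
  t : ℕ
  comp : Fin t → H.Subgraph
  disj : ∀ i j, i ≠ j → Disjoint (comp i).verts (comp j).verts
  covers : ∀ v : V, ∃ i, v ∈ (comp i).verts
  cycleOrStar : ∀ i, IsOddCycleGraph (comp i).coe ∨ IsStarGraph (comp i).coe

/-- `f` is a fractional edge cover of `H`: nonnegative, supported on the edges of `H`, and at
every vertex the incident weights sum to at least `1`. -/
def IsFracEdgeCover {V : Type*} [Fintype V] [DecidableEq V] (H : SimpleGraph V)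
    [DecidableRel H.Adj] (f : Sym2 V → ℝ) : Prop :=
  (∀ e, 0 ≤ f e) ∧ (∀ e, e ∉ H.edgeSet → f e = 0) ∧
    ∀ v : V, 1 ≤ ∑ e ∈ H.incidenceFinset v, f e

/-- The cost of a fractional edge cover: the sum of its values over the edges of `H`. -/
def coverCost {V : Type*} [Fintype V] [DecidableEq V] (H : SimpleGraph V)
    [DecidableRel H.Adj] (f : Sym2 V → ℝ) : ℝ :=
  ∑ e ∈ H.edgeFinset, f e

/-- The fractional edge cover number `ρ(H)`: the infimum of the costs of fractional edge
covers of `H`. -/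
noncomputable def fracEdgeCoverNumber {V : Type*} [Fintype V] [DecidableEq V]
    (H : SimpleGraph V) [DecidableRel H.Adj] : ℝ :=
  sInf (coverCost H '' {f | IsFracEdgeCover H f})

section Helpers

variable {V : Type*}

/-- The star subgraph with centre `t` and petal set `L`. -/
def starSub (H : SimpleGraph V) (t : V) (L : Finset V) (h : ∀ l ∈ L, H.Adj t l) :
    H.Subgraph where
  verts := {x | x = t ∨ x ∈ L}
  Adj x y := (x = t ∧ y ∈ L) ∨ (y = t ∧ x ∈ L)
  adj_sub := by
    rintro x y (⟨rfl, hy⟩ | ⟨rfl, hx⟩)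
    · exact h _ hy
    · exact (h _ hx).symm
  edge_vert := by
    rintro x y (⟨rfl, hy⟩ | ⟨rfl, hx⟩)
    · exact Or.inl rfl
    · exact Or.inr hx
  symm := by
    constructor
    rintro x y (hx | hy)
    · exact Or.inr hx
    · exact Or.inl hy

lemma starSub_isStar (H : SimpleGraph V) (t : V) (L : Finset V) (h : ∀ l ∈ L, H.Adj t l)
    (hL : L.Nonempty) : IsStarGraph (starSub H t L h).coe := by
  classical
  have htL : t ∉ L := fun ht => H.loopless.irrefl _ (h t ht)
  refine ⟨L.card, hL.card_pos, ⟨?_⟩⟩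
  let F : Fin 1 ⊕ Fin L.card → (starSub H t L h).verts :=
    Sum.elim (fun _ => ⟨t, Or.inl rfl⟩) (fun i => ⟨(L.equivFin.symm i : V), Or.inr (L.equivFin.symm i).2⟩)
  have hF : Function.Bijective F := by
    constructor
    · rintro (a | a) (b | b) hab
      · congr 1; exact Subsingleton.elim _ _
      · exfalso
        have : t = (L.equivFin.symm b : V) := congrArg Subtype.val hab
        exact htL (this ▸ (L.equivFin.symm b).2)
      · exfalso
        have : (L.equivFin.symm a : V) = t := congrArg Subtype.val hab
        exact htL (this ▸ (L.equivFin.symm a).2)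
      · have : (L.equivFin.symm a : V) = (L.equivFin.symm b : V) :=
          congrArg (fun z : (starSub H t L h).verts => (z : V)) hab
        congr 1
        exact L.equivFin.symm.injective (Subtype.ext this)
    · rintro ⟨x, (rfl | hx)⟩
      · exact ⟨Sum.inl 0, rfl⟩
      · exact ⟨Sum.inr (L.equivFin ⟨x, hx⟩), by simp [F]⟩
  refine (RelIso.symm ⟨Equiv.ofBijective F hF, ?_⟩)
  rintro (a | a) (b | b)
  · simp only [Equiv.ofBijective_apply, F, Sum.elim_inl, Subgraph.coe_adj]
    simp [starSub, htL]
  · simp only [Equiv.ofBijective_apply, F, Sum.elim_inl, Sum.elim_inr, Subgraph.coe_adj]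
    simp [starSub]
  · simp only [Equiv.ofBijective_apply, F, Sum.elim_inl, Sum.elim_inr, Subgraph.coe_adj]
    simp [starSub]
  · simp only [Equiv.ofBijective_apply, F, Sum.elim_inr, Subgraph.coe_adj]
    simp only [completeBipartiteGraph_adj, Sum.isLeft_inr, Sum.isRight_inr]
    have : ∀ a, (L.equivFin.symm a : V) ≠ t := fun a ha => htL (ha ▸ (L.equivFin.symm a).2)
    simp [starSub, this]

lemma not_odd_and_star {W : Type*} (G : SimpleGraph W) (h1 : IsOddCycleGraph G)
    (h2 : IsStarGraph G) : False := by
  obtain ⟨k, hk, hk3, ⟨e⟩⟩ := h1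
  obtain ⟨p, hp, ⟨e'⟩⟩ := h2
  have hc : (cycleGraph k).Colorable 2 := by
    have := (CompleteBipartiteGraph.bicoloring (Fin 1) (Fin p)).colorable
    rw [Fintype.card_bool] at this
    exact this.of_hom (e'.toHom.comp e.symm.toHom)
  have h3 := chromaticNumber_cycleGraph_of_odd k (by omega) hk
  have := hc.chromaticNumber_le
  rw [h3] at this
  exact absurd this (by decide)

lemma oddCycle_nbrs {W : Type*} (G : SimpleGraph W) (h1 : IsOddCycleGraph G) (v : W) :
    ∃ a b, a ≠ b ∧ ∀ w, G.Adj v w ↔ w = a ∨ w = b := by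
  obtain ⟨k, hk, hk3, ⟨e⟩⟩ := h1
  obtain ⟨n, rfl⟩ : ∃ n, k = n + 3 := ⟨k - 3, by omega⟩
  have h := cycleGraph_degree_three_le (n := n) (v := e v)
  rw [SimpleGraph.degree, Finset.card_eq_two] at h
  obtain ⟨a, b, hab, h⟩ := h
  refine ⟨e.symm a, e.symm b, fun h => hab (e.symm.injective h), fun w => ?_⟩
  rw [← e.map_adj_iff, ← SimpleGraph.mem_neighborFinset, h]
  simp only [Finset.mem_insert, Finset.mem_singleton]
  constructor
  · rintro (h | h) <;> [left; right] <;> rw [← h] <;> simp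
  · rintro (h | h) <;> [left; right] <;> rw [h] <;> simp

lemma star_nbr {W : Type*} (G : SimpleGraph W) (h1 : IsStarGraph G) (v : W) :
    ∃ w, G.Adj v w := by
  obtain ⟨p, hp, ⟨e⟩⟩ := h1
  rcases hv : e v with a | a
  · refine ⟨e.symm (Sum.inr ⟨0, hp⟩), ?_⟩
    rw [← e.map_adj_iff, hv]; simp
  · refine ⟨e.symm (Sum.inl 0), ?_⟩
    rw [← e.map_adj_iff, hv]; simp

variable [Fintype V] [DecidableEq V]

lemma sum_incidence (H : SimpleGraph V) [DecidableRel H.Adj] (f : Sym2 V → ℝ) (v : V) :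
    ∑ e ∈ H.incidenceFinset v, f e = ∑ w, if H.Adj v w then f s(v, w) else 0 := by
  rw [← Finset.sum_filter]
  symm
  refine Finset.sum_bij (fun w _ => s(v, w)) ?_ ?_ ?_ ?_
  · intro w hw
    simpa using hw
  · intro a _ b _ h
    exact Sym2.congr_right.mp h
  · intro e he
    induction e using Sym2.ind with
    | _ x y =>
      rw [mem_incidenceFinset, mk'_mem_incidenceSet_iff] at he
      rcases he with ⟨h, rfl | rfl⟩
      · exact ⟨y, by simpa using h, rfl⟩
      · exact ⟨x, by simpa using h.symm, Sym2.eq_swap⟩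
  · intros; rfl

lemma sum_double (H : SimpleGraph V) [DecidableRel H.Adj] (f : Sym2 V → ℝ) (y : V → ℝ) :
    ∑ v, y v * ∑ e ∈ H.incidenceFinset v, f e =
      ∑ e ∈ H.edgeFinset, f e * ∑ v, if v ∈ e then y v else 0 := by
  have h1 : ∀ v, y v * ∑ e ∈ H.incidenceFinset v, f e =
      ∑ e ∈ H.edgeFinset, f e * if v ∈ e then y v else 0 := by
    intro v
    rw [incidenceFinset_eq_filter, Finset.sum_filter, Finset.mul_sum]
    refine Finset.sum_congr rfl fun e _ => ?_
    split_ifs <;> ring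
  simp_rw [h1, Finset.mul_sum]
  exact Finset.sum_comm

lemma sum_mem_pair (y : V → ℝ) {a b : V} (hab : a ≠ b) :
    (∑ v, if v ∈ s(a, b) then y v else 0) = y a + y b := by
  rw [← Finset.sum_filter]
  have : Finset.univ.filter (fun v => v ∈ s(a, b)) = {a, b} := by ext; simp
  rw [this, Finset.sum_pair hab]

lemma cycle_sub (H : SimpleGraph V) (k : ℕ) (hk : 3 ≤ k) (hodd : Odd k) (g : ℕ → V)
    (hinj : ∀ i < k, ∀ j < k, g i = g j → i = j) (hadj : ∀ i, H.Adj (g i) (g (i + 1)))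
    (hk0 : g k = g 0) :
    ∃ C : H.Subgraph, IsOddCycleGraph C.coe ∧ ∀ x, x ∈ C.verts ↔ ∃ i < k, g i = x := by
  have key : ∀ i j : Fin k, (i - j).val = 1 → H.Adj (g j) (g i) := by
    intro i j hij
    have hi := i.2
    have hj := j.2
    by_cases hle : j ≤ i
    · rw [Fin.sub_val_of_le hle] at hij
      have : (i : ℕ) = j + 1 := by omega
      rw [this]; exact hadj j
    · have hlt : i < j := not_le.mp hle
      rw [Fin.coe_sub_iff_lt.mpr hlt] at hij
      have h1 : (i : ℕ) = 0 := by omega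
      have h2 : k = (j : ℕ) + 1 := by omega
      rw [h1, ← hk0]
      have := hadj j
      rwa [← h2] at this
  let φ : cycleGraph k →g H := ⟨fun i => g i, by
    intro a b hab
    rw [cycleGraph_adj'] at hab
    rcases hab with h | h
    · exact (key _ _ h).symm
    · exact key _ _ h⟩
  let c : Copy (cycleGraph k) H := ⟨φ, fun i j h => Fin.ext (hinj i i.2 j j.2 h)⟩
  refine ⟨c.toSubgraph, ⟨k, hodd, hk, ⟨c.isoToSubgraph.symm⟩⟩, fun x => ?_⟩
  simp only [Subgraph.map_verts, Subgraph.verts_top, Set.image_univ, Set.mem_range]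
  constructor
  · rintro ⟨i, rfl⟩; exact ⟨i, i.2, rfl⟩
  · rintro ⟨i, hi, rfl⟩; exact ⟨⟨i, hi⟩, rfl⟩

lemma perm_decomp (H : SimpleGraph V) (σ : Equiv.Perm V) (n : ℕ) : ∀ R : Finset V, R.card = n →
    (∀ v ∈ R, σ v ∈ R ∧ H.Adj v (σ v)) →
    ∃ S : Set H.Subgraph, (∀ C ∈ S, IsOddCycleGraph C.coe ∨
        ∃ a b, ∃ h, a ≠ b ∧ C = starSub H a {b} h) ∧
      (∀ C ∈ S, ∀ C' ∈ S, C ≠ C' → Disjoint C.verts C'.verts) ∧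
      ∀ x, x ∈ R ↔ ∃ C ∈ S, x ∈ C.verts := by
  induction n using Nat.strong_induction_on with
  | _ n ih =>
  intro R hR hσ
  rcases R.eq_empty_or_nonempty with rfl | ⟨v, hv⟩
  · exact ⟨∅, by simp, by simp, by simp⟩
  set k := Function.minimalPeriod σ v with hkdef
  set g : ℕ → V := fun i => σ^[i] v with hg
  have hkpos : 0 < k := Function.minimalPeriod_pos_of_mem_periodicPts
    (σ.injective.mem_periodicPts v)
  have hinj : ∀ i < k, ∀ j < k, g i = g j → i = j := fun i hi j hj h =>
    Function.iterate_injOn_Iio_minimalPeriod hi hj h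
  have hgk : g k = g 0 := Function.iterate_minimalPeriod
  have hgs : ∀ i, g (i + 1) = σ (g i) := fun i => Function.iterate_succ_apply' σ i v
  have hgR : ∀ i, g i ∈ R := by
    intro i
    induction i with
    | zero => exact hv
    | succ i hi => rw [hgs]; exact (hσ _ hi).1
  have hadj : ∀ i, H.Adj (g i) (g (i + 1)) := fun i => by rw [hgs]; exact (hσ _ (hgR i)).2
  have hk1 : k ≠ 1 := by
    intro h
    have := hadj 0
    rw [zero_add, ← h, hgk] at this
    exact H.loopless.irrefl _ this
  -- decomposition of the orbit
  have horb : ∃ S : Set H.Subgraph, (∀ C ∈ S, IsOddCycleGraph C.coe ∨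
        ∃ a b, ∃ h, a ≠ b ∧ C = starSub H a {b} h) ∧
      (∀ C ∈ S, ∀ C' ∈ S, C ≠ C' → Disjoint C.verts C'.verts) ∧
      ∀ x, (∃ i < k, g i = x) ↔ ∃ C ∈ S, x ∈ C.verts := by
    rcases Nat.even_or_odd k with he | ho
    · obtain ⟨m, hm⟩ := he
      have hst : ∀ i, ∀ l ∈ ({g (2 * i + 1)} : Finset V), H.Adj (g (2 * i)) l := by
        intro i l hl
        rw [Finset.mem_singleton] at hl
        rw [hl]; exact hadj _
      refine ⟨{C | ∃ i < m, C = starSub H (g (2 * i)) {g (2 * i + 1)} (hst i)}, ?_, ?_, ?_⟩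
      · rintro C ⟨i, hi, rfl⟩
        exact Or.inr ⟨_, _, _, (hadj _).ne, rfl⟩
      · rintro C ⟨i, hi, rfl⟩ C' ⟨j, hj, rfl⟩ hne
        have hij : i ≠ j := by rintro rfl; exact hne rfl
        rw [Set.disjoint_left]
        intro x hx hx'
        simp only [starSub, Finset.mem_singleton, Set.mem_ofPred_eq] at hx hx'
        rcases hx with hx | hx <;> rcases hx' with hx' | hx' <;>
        · have := hinj _ (by omega) _ (by omega) (hx.symm.trans hx')
          omega
      · intro x
        constructor
        · rintro ⟨i, hi, rfl⟩
          refine ⟨_, ⟨i / 2, by omega, rfl⟩, ?_⟩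
          simp only [starSub, Finset.mem_singleton, Set.mem_ofPred_eq]
          rcases Nat.even_or_odd' i with ⟨c, hc | hc⟩
          · left; congr 1; omega
          · right; congr 1; omega
        · rintro ⟨C, ⟨i, hi, rfl⟩, hx⟩
          simp only [starSub, Finset.mem_singleton, Set.mem_ofPred_eq] at hx
          rcases hx with rfl | rfl
          · exact ⟨_, by omega, rfl⟩
          · exact ⟨_, by omega, rfl⟩
    · have hk3 : 3 ≤ k := by obtain ⟨m, hm⟩ := ho; omega
      obtain ⟨C, hC, hCv⟩ := cycle_sub H k hk3 ho g hinj hadj hgk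
      refine ⟨{C}, ?_, ?_, ?_⟩
      · rintro _ rfl; exact Or.inl hC
      · rintro _ rfl _ rfl h; exact absurd rfl h
      · intro x; simp [hCv]
  obtain ⟨S₁, h1, h2, h3⟩ := horb
  set R' := R.filter (fun x => ¬ ∃ i < k, g i = x) with hR'
  have hcard : R'.card < n := by
    rw [← hR]
    refine Finset.card_lt_card (Finset.filter_ssubset.mpr ⟨v, hv, ?_⟩)
    exact not_not.mpr ⟨0, hkpos, rfl⟩
  have hσ' : ∀ w ∈ R', σ w ∈ R' ∧ H.Adj w (σ w) := by
    intro w hw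
    rw [hR', Finset.mem_filter] at hw
    refine ⟨?_, (hσ w hw.1).2⟩
    rw [hR', Finset.mem_filter]
    refine ⟨(hσ w hw.1).1, ?_⟩
    rintro ⟨i, hi, hiw⟩
    apply hw.2
    rcases i with _ | i
    · refine ⟨k - 1, by omega, σ.injective ?_⟩
      rw [← hgs, Nat.sub_add_cancel hkpos, hgk, hiw]
    · refine ⟨i, by omega, σ.injective ?_⟩
      rw [← hgs, hiw]
  obtain ⟨S₂, g1, g2, g3⟩ := ih _ hcard R' rfl hσ'
  have hdis : ∀ C ∈ S₁, ∀ C' ∈ S₂, Disjoint C.verts C'.verts := by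
    intro C hC C' hC'
    rw [Set.disjoint_left]
    intro x hx hx'
    have := (g3 x).mpr ⟨C', hC', hx'⟩
    rw [hR', Finset.mem_filter] at this
    exact this.2 ((h3 x).mpr ⟨C, hC, hx⟩)
  refine ⟨S₁ ∪ S₂, ?_, ?_, ?_⟩
  · rintro C (hC | hC)
    · exact h1 C hC
    · exact g1 C hC
  · rintro C (hC | hC) C' (hC' | hC') hne
    · exact h2 C hC C' hC' hne
    · exact hdis C hC C' hC'
    · exact (hdis C' hC' C hC).symm
    · exact g2 C hC C' hC' hne
  · intro x
    have hx : x ∈ R ↔ (∃ i < k, g i = x) ∨ x ∈ R' := by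
      rw [hR', Finset.mem_filter]
      constructor
      · intro h
        by_cases h' : ∃ i < k, g i = x
        · exact Or.inl h'
        · exact Or.inr ⟨h, h'⟩
      · rintro (⟨i, _, rfl⟩ | h)
        · exact hgR i
        · exact h.1
    rw [hx, h3, g3]
    constructor
    · rintro (⟨C, hC, h⟩ | ⟨C, hC, h⟩)
      · exact ⟨C, Or.inl hC, h⟩
      · exact ⟨C, Or.inr hC, h⟩
    · rintro ⟨C, hC | hC, h⟩
      · exact Or.inl ⟨C, hC, h⟩
      · exact Or.inr ⟨C, hC, h⟩

/-- The open neighbourhood of a finite set of vertices. -/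
def nbhd (H : SimpleGraph V) [DecidableRel H.Adj] (A : Finset V) : Finset V :=
  Finset.univ.filter (fun x => ∃ a ∈ A, H.Adj a x)

lemma mem_nbhd (H : SimpleGraph V) [DecidableRel H.Adj] (A : Finset V) (x : V) :
    x ∈ nbhd H A ↔ ∃ a ∈ A, H.Adj a x := by simp [nbhd]

lemma exists_max_indep (H : SimpleGraph V) [DecidableRel H.Adj] :
    ∃ I : Finset V, Disjoint I (nbhd H I) ∧
      ∀ A : Finset V, A.card + (nbhd H I).card ≤ I.card + (nbhd H A).card := by
  obtain ⟨S, -, hS⟩ := Finset.exists_max_image (Finset.univ : Finset (Finset V))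
    (fun A => (A.card : ℤ) - (nbhd H A).card) ⟨∅, Finset.mem_univ _⟩
  refine ⟨S \ nbhd H S, ?_, ?_⟩
  · rw [Finset.disjoint_left]
    intro x hx hx'
    rw [mem_nbhd] at hx'
    obtain ⟨a, ha, hax⟩ := hx'
    rw [Finset.mem_sdiff] at hx ha
    exact hx.2 ((mem_nbhd H _ _).mpr ⟨a, ha.1, hax⟩)
  · intro A
    have hA := hS A (Finset.mem_univ _)
    have h1 : nbhd H (S \ nbhd H S) ⊆ nbhd H S \ S := by
      intro x hx
      obtain ⟨a, ha, hax⟩ := (mem_nbhd H _ _).mp hx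
      rw [Finset.mem_sdiff] at ha ⊢
      exact ⟨(mem_nbhd H _ _).mpr ⟨a, ha.1, hax⟩,
        fun hxS => ha.2 ((mem_nbhd H _ _).mpr ⟨x, hxS, hax.symm⟩)⟩
    have h2 := Finset.card_le_card h1
    have h3 := Finset.card_sdiff_add_card_inter S (nbhd H S)
    have h4 := Finset.card_sdiff_add_card_inter (nbhd H S) S
    rw [Finset.inter_comm] at h4
    omega

/-- Hall's theorem between two finite sets of vertices. -/
lemma hall_between (H : SimpleGraph V) [DecidableRel H.Adj] (X Y : Finset V)
    (h : ∀ B ⊆ X, B.card ≤ (nbhd H B ∩ Y).card) :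
    ∃ m : V → V, (∀ x ∈ X, m x ∈ Y ∧ H.Adj x (m x)) ∧
      ∀ x ∈ X, ∀ x' ∈ X, m x = m x' → x = x' := by
  have := (Finset.all_card_le_biUnion_card_iff_exists_injective
    (fun x : X => Y.filter (fun y => H.Adj x y))).mp (by
      intro s
      have hs := h (s.map (Function.Embedding.subtype _)) (by
        intro x hx
        simp only [Finset.mem_map, Function.Embedding.subtype_apply] at hx
        obtain ⟨a, _, rfl⟩ := hx
        exact a.2)
      rw [Finset.card_map] at hs
      refine hs.trans (Finset.card_le_card ?_)
      intro y hy
      rw [Finset.mem_inter, mem_nbhd] at hy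
      obtain ⟨⟨a, ha, hay⟩, hyY⟩ := hy
      simp only [Finset.mem_map, Function.Embedding.subtype_apply] at ha
      obtain ⟨b, hb, rfl⟩ := ha
      rw [Finset.mem_biUnion]
      exact ⟨b, hb, Finset.mem_filter.mpr ⟨hyY, hay⟩⟩)
  obtain ⟨m, hm, hm'⟩ := this
  refine ⟨fun x => if hx : x ∈ X then m ⟨x, hx⟩ else x, ?_, ?_⟩
  · intro x hx
    have := hm' ⟨x, hx⟩
    rw [Finset.mem_filter] at this
    simpa [hx] using this
  · intro x hx x' hx' he
    simp only [hx, hx', dif_pos] at he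
    exact congrArg Subtype.val (hm he)

lemma exists_dual (H : SimpleGraph V) [DecidableRel H.Adj] (hiso : ∀ v : V, 0 < H.degree v) :
    ∃ (y : V → ℝ) (S : Set H.Subgraph), (∀ v, 0 ≤ y v) ∧
      (∀ u v, H.Adj u v → y u + y v ≤ 1) ∧
      (∀ C ∈ S, ∀ u v, C.Adj u v → y u + y v = 1) ∧
      (∀ C ∈ S, IsOddCycleGraph C.coe ∨ (IsStarGraph C.coe ∧
        ∀ v, y v ≠ 0 → ∀ a b, C.Adj v a → C.Adj v b → a = b)) ∧
      (∀ C ∈ S, ∀ C' ∈ S, C ≠ C' → Disjoint C.verts C'.verts) ∧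
      ∀ x, ∃ C ∈ S, x ∈ C.verts := by
  obtain ⟨I, hdisj, hmax⟩ := exists_max_indep H
  set T := nbhd H I with hT
  set R := Finset.univ \ (I ∪ T) with hRdef
  have hmemT : ∀ x, x ∈ T ↔ ∃ a ∈ I, H.Adj a x := mem_nbhd H I
  have hmemR : ∀ x, x ∈ R ↔ x ∉ I ∧ x ∉ T := by intro x; simp [hRdef]
  have hIT : ∀ x ∈ I, x ∉ T := fun x hx => Finset.disjoint_left.mp hdisj hx
  -- the permutation of R
  obtain ⟨s, hs, hsinj⟩ := hall_between H R R (by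
    intro A hA
    have h1 := hmax (I ∪ A)
    have hIA : Disjoint I A := by
      rw [Finset.disjoint_left]
      intro x hx hx'
      exact ((hmemR x).mp (hA hx')).1 hx
    rw [Finset.card_union_of_disjoint hIA] at h1
    have h2 : nbhd H (I ∪ A) ⊆ T ∪ (nbhd H A ∩ R) := by
      intro x hx
      obtain ⟨a, ha, hax⟩ := (mem_nbhd H _ _).mp hx
      rw [Finset.mem_union, Finset.mem_inter, mem_nbhd H A, hmemR]
      by_cases hxT : x ∈ T
      · exact Or.inl hxT
      · right
        rcases Finset.mem_union.mp ha with ha | ha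
        · exact absurd ((hmemT x).mpr ⟨a, ha, hax⟩) hxT
        · refine ⟨⟨a, ha, hax⟩, fun hxI => ?_, hxT⟩
          exact ((hmemR a).mp (hA ha)).2 ((hmemT a).mpr ⟨x, hxI, hax.symm⟩)
    have h3 := Finset.card_le_card h2
    have h4 := Finset.card_union_le T (nbhd H A ∩ R)
    omega)
  have hσinj : Function.Injective (fun v => if v ∈ R then s v else v) := by
    intro a b hab
    simp only at hab
    split_ifs at hab with ha hb hb
    · exact hsinj a ha b hb hab
    · exact absurd (hab ▸ (hs a ha).1) hb
    · exact absurd (hab.symm ▸ (hs b hb).1) ha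
    · exact hab
  let σ : Equiv.Perm V := Equiv.ofBijective _ (Finite.injective_iff_bijective.mp hσinj)
  have hσ : ∀ v ∈ R, σ v ∈ R ∧ H.Adj v (σ v) := by
    intro v hv
    have : σ v = s v := by
      change (if v ∈ R then s v else v) = s v
      rw [if_pos hv]
    rw [this]; exact hs v hv
  obtain ⟨S, hS1, hS2, hS3⟩ := perm_decomp H σ R.card R rfl hσ
  -- the matching of T into I
  obtain ⟨m, hm, hminj⟩ := hall_between H T I (by
    intro B hB
    have h1 := hmax (I \ nbhd H B)
    have h2 : nbhd H (I \ nbhd H B) ⊆ T \ B := by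
      intro x hx
      obtain ⟨a, ha, hax⟩ := (mem_nbhd H _ _).mp hx
      rw [Finset.mem_sdiff] at ha ⊢
      exact ⟨(hmemT x).mpr ⟨a, ha.1, hax⟩,
        fun hxB => ha.2 ((mem_nbhd H _ _).mpr ⟨x, hxB, hax.symm⟩)⟩
    have h3 := Finset.card_le_card h2
    have h4 := Finset.card_sdiff_add_card_inter I (nbhd H B)
    have h5 := Finset.card_sdiff_add_card_eq_card hB
    rw [Finset.inter_comm] at h4
    omega)
  have hc : ∃ c : V → V, (∀ v, H.Adj v (c v)) ∧ ∀ t ∈ T, c (m t) = t := by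
    have : ∀ v, ∃ w, H.Adj v w ∧ ∀ t ∈ T, m t = v → w = t := by
      intro v
      by_cases h : ∃ t ∈ T, m t = v
      · obtain ⟨t, ht, rfl⟩ := h
        exact ⟨t, (hm t ht).2.symm, fun t' ht' h' => hminj t ht t' ht' h'.symm⟩
      · obtain ⟨w, hw⟩ := (H.degree_pos_iff_exists_adj v).mp (hiso v)
        exact ⟨w, hw, fun t ht h' => absurd ⟨t, ht, h'⟩ h⟩
    choose c hc1 hc2 using this
    exact ⟨c, hc1, fun t ht => hc2 _ t ht rfl⟩
  obtain ⟨c, hc1, hc2⟩ := hc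
  let L : V → Finset V := fun t => I.filter (fun v => c v = t)
  have hL : ∀ t v, v ∈ L t ↔ v ∈ I ∧ c v = t := fun t v => Finset.mem_filter
  have hLadj : ∀ t, ∀ l ∈ L t, H.Adj t l := by
    intro t l hl
    have := hc1 l
    rw [((hL t l).mp hl).2] at this
    exact this.symm
  have hLne : ∀ t ∈ T, (L t).Nonempty := fun t ht =>
    ⟨m t, (hL _ _).mpr ⟨(hm t ht).1, hc2 t ht⟩⟩
  let y : V → ℝ := fun v => if v ∈ I then 1 else if v ∈ T then 0 else 1 / 2
  have hyI : ∀ v ∈ I, y v = 1 := fun v hv => if_pos hv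
  have hyT : ∀ v ∈ T, y v = 0 := fun v hv => by
    have : v ∉ I := fun h => hIT v h hv
    simp [y, this, hv]
  have hyR : ∀ v ∈ R, y v = 1 / 2 := fun v hv => by
    have := (hmemR v).mp hv
    simp [y, this.1, this.2]
  have hhalf : ∀ v, v ∉ I → y v ≤ 1 / 2 := fun v hv => by
    simp only [y, if_neg hv]
    split_ifs <;> norm_num
  have hSR : ∀ C ∈ S, ∀ x ∈ C.verts, x ∈ R := fun C hC x hx => (hS3 x).mpr ⟨C, hC, hx⟩
  have hmix : ∀ t ∈ T, ∀ C ∈ S, Disjoint (starSub H t (L t) (hLadj t)).verts C.verts := by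
    intro t ht C hC
    rw [Set.disjoint_left]
    intro x hx hx'
    have := (hmemR x).mp (hSR C hC x hx')
    simp only [starSub, Set.mem_ofPred_eq] at hx
    rcases hx with rfl | hx
    · exact this.2 ht
    · exact this.1 ((hL _ _).mp hx).1
  refine ⟨y, {C | ∃ t ∈ T, C = starSub H t (L t) (hLadj t)} ∪ S, ?_, ?_, ?_, ?_, ?_, ?_⟩
  · intro v
    simp only [y]
    split_ifs <;> norm_num
  · intro u v huv
    by_cases hu : u ∈ I
    · rw [hyI u hu, hyT v ((hmemT v).mpr ⟨u, hu, huv⟩)]; norm_num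
    · by_cases hv : v ∈ I
      · rw [hyI v hv, hyT u ((hmemT u).mpr ⟨v, hv, huv.symm⟩)]; norm_num
      · linarith [hhalf u hu, hhalf v hv]
  · rintro C (⟨t, ht, rfl⟩ | hC) u v huv
    · rcases huv with ⟨rfl, hv⟩ | ⟨rfl, hu⟩
      · rw [hyT _ ht, hyI _ ((hL _ _).mp hv).1]; norm_num
      · rw [hyT _ ht, hyI _ ((hL _ _).mp hu).1]; norm_num
    · rw [hyR u (hSR C hC u (C.edge_vert huv)), hyR v (hSR C hC v (C.edge_vert huv.symm))]
      norm_num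
  · rintro C (⟨t, ht, rfl⟩ | hC)
    · right
      refine ⟨starSub_isStar _ _ _ _ (hLne t ht), ?_⟩
      intro v hv a b ha hb
      have hvt : v ≠ t := by rintro rfl; exact hv (hyT _ ht)
      rcases ha with ha | ha
      · exact absurd ha.1 hvt
      · rcases hb with hb | hb
        · exact absurd hb.1 hvt
        · exact ha.1.trans hb.1.symm
    · rcases hS1 C hC with h | ⟨a, b, h, hab, rfl⟩
      · exact Or.inl h
      · right
        refine ⟨starSub_isStar _ _ _ _ (Finset.singleton_nonempty _), ?_⟩
        intro v _ x z hx hz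
        simp only [starSub, Finset.mem_singleton] at hx hz
        rcases hx with ⟨h1, h2⟩ | ⟨h1, h2⟩ <;> rcases hz with ⟨h3, h4⟩ | ⟨h3, h4⟩
        · rw [h2, h4]
        · exact absurd (h1.symm.trans h4) hab
        · exact absurd (h3.symm.trans h2) hab
        · rw [h1, h3]
  · rintro C (⟨t, ht, rfl⟩ | hC) C' (⟨t', ht', rfl⟩ | hC') hne
    · have htt : t ≠ t' := by rintro rfl; exact hne rfl
      rw [Set.disjoint_left]
      intro x hx hx'
      simp only [starSub, Set.mem_ofPred_eq, hL] at hx hx'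
      rcases hx with hx | hx <;> rcases hx' with hx' | hx'
      · exact htt (hx.symm.trans hx')
      · exact hIT x hx'.1 (hx ▸ ht)
      · exact hIT x hx.1 (hx' ▸ ht')
      · exact htt (hx.2.symm.trans hx'.2)
    · exact hmix t ht C' hC'
    · exact (hmix t' ht' C hC).symm
    · exact hS2 C hC C' hC' hne
  · intro x
    by_cases hxI : x ∈ I
    · refine ⟨_, Or.inl ⟨c x, (hmemT _).mpr ⟨x, hxI, hc1 x⟩, rfl⟩, Or.inr ((hL _ _).mpr ⟨hxI, rfl⟩)⟩
    · by_cases hxT : x ∈ T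
      · exact ⟨_, Or.inl ⟨x, hxT, rfl⟩, Or.inl rfl⟩
      · obtain ⟨C, hC, hx⟩ := (hS3 x).mp ((hmemR x).mpr ⟨hxI, hxT⟩)
        exact ⟨C, Or.inr hC, hx⟩

end Helpers

/-- Every finite simple graph `H` with no isolated vertices admits a
fractional edge cover `x*` of minimum cost `ρ(H)` (in particular the minimum is attained),
together with a valid decomposition of `H` into vertex-disjoint odd cycles and stars covering
all vertices, such that `x*` equals `1/2` on the edges of the odd cycles, `1` on the edges of
the stars, and `0` on every other edge of `H`. -/
theorem exists_optimal_fracEdgeCover_decomposition {V : Type*} [Fintype V] [DecidableEq V]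
    (H : SimpleGraph V) [DecidableRel H.Adj] (hiso : ∀ v : V, 0 < H.degree v) :
    ∃ (f : Sym2 V → ℝ) (D : ValidDecomposition H),
      IsFracEdgeCover H f ∧
      coverCost H f = fracEdgeCoverNumber H ∧
      (∀ i, IsOddCycleGraph (D.comp i).coe → ∀ e ∈ (D.comp i).edgeSet, f e = 1 / 2) ∧
      (∀ i, IsStarGraph (D.comp i).coe → ∀ e ∈ (D.comp i).edgeSet, f e = 1) ∧
      (∀ e ∈ H.edgeSet, (∀ i, e ∉ (D.comp i).edgeSet) → f e = 0) := by
  classical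
  obtain ⟨y, S, hy0, hy1, hyC, hS, hSd, hSc⟩ := exists_dual H hiso
  have hfin : Finite S := inferInstance
  obtain ⟨t, ⟨E⟩⟩ := Finite.exists_equiv_fin S
  let D : ValidDecomposition H :=
    { t := t
      comp := fun i => (E.symm i).1
      disj := fun i j hij => hSd _ (E.symm i).2 _ (E.symm j).2
        (fun h => hij (E.symm.injective (Subtype.ext h)))
      covers := fun v => by
        obtain ⟨C, hC, hv⟩ := hSc v
        exact ⟨E ⟨C, hC⟩, by simpa using hv⟩
      cycleOrStar := fun i => (hS _ (E.symm i).2).imp_right (fun h => h.1) }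
  have huniq : ∀ C ∈ S, ∀ C' ∈ S, ∀ v, v ∈ C.verts → v ∈ C'.verts → C = C' := by
    intro C hC C' hC' v hv hv'
    by_contra hne
    exact Set.disjoint_left.mp (hSd C hC C' hC' hne) hv hv'
  have huniqe : ∀ C ∈ S, ∀ C' ∈ S, ∀ e, e ∈ C.edgeSet → e ∈ C'.edgeSet → C = C' := by
    intro C hC C' hC' e he he'
    induction e using Sym2.ind with
    | _ a b => exact huniq C hC C' hC' a (C.edge_vert he) (C'.edge_vert he')
  let f : Sym2 V → ℝ := fun e =>
    if ∃ C ∈ S, IsOddCycleGraph C.coe ∧ e ∈ C.edgeSet then 1 / 2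
    else if ∃ C ∈ S, e ∈ C.edgeSet then 1 else 0
  have hf0 : ∀ e, 0 ≤ f e := by
    intro e
    simp only [f]
    split_ifs <;> norm_num
  have hfodd : ∀ C ∈ S, IsOddCycleGraph C.coe → ∀ e ∈ C.edgeSet, f e = 1 / 2 :=
    fun C hC ho e he => if_pos ⟨C, hC, ho, he⟩
  have hfstar : ∀ C ∈ S, IsStarGraph C.coe → ∀ e ∈ C.edgeSet, f e = 1 := by
    intro C hC hs e he
    have h1 : ¬ ∃ C ∈ S, IsOddCycleGraph C.coe ∧ e ∈ C.edgeSet := by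
      rintro ⟨C', hC', ho, he'⟩
      have := huniqe C hC C' hC' e he he'
      subst this
      exact not_odd_and_star _ ho hs
    have h2 : ∃ C ∈ S, e ∈ C.edgeSet := ⟨C, hC, he⟩
    simp only [f, if_neg h1, if_pos h2]
  have hfz : ∀ e, (∀ C ∈ S, e ∉ C.edgeSet) → f e = 0 := by
    intro e he
    have h1 : ¬ ∃ C ∈ S, IsOddCycleGraph C.coe ∧ e ∈ C.edgeSet := by
      rintro ⟨C', hC', ho, he'⟩
      exact he _ hC' he'
    have h2 : ¬ ∃ C ∈ S, e ∈ C.edgeSet := by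
      rintro ⟨C', hC', he'⟩
      exact he _ hC' he'
    simp only [f, if_neg h1, if_neg h2]
  -- the weight at a vertex
  have hloc : ∀ v, ∀ C ∈ S, v ∈ C.verts → ∀ r : ℝ, (∀ e ∈ C.edgeSet, f e = r) →
      ∑ e ∈ H.incidenceFinset v, f e = ∑ w, if C.Adj v w then r else 0 := by
    intro v C hC hv r hr
    rw [sum_incidence]
    refine Finset.sum_congr rfl fun w _ => ?_
    by_cases hvw : C.Adj v w
    · rw [if_pos hvw, if_pos (C.adj_sub hvw)]
      exact hr _ hvw
    · rw [if_neg hvw]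
      have : f s(v, w) = 0 := by
        apply hfz
        intro C' hC' he
        have := huniq C hC C' hC' v hv (C'.edge_vert he)
        subst this
        exact hvw he
      rw [this, ite_self]
  have hdeg : ∀ v, 1 ≤ ∑ e ∈ H.incidenceFinset v, f e ∧
      (y v ≠ 0 → ∑ e ∈ H.incidenceFinset v, f e = 1) := by
    intro v
    obtain ⟨C, hC, hv⟩ := hSc v
    rcases hS C hC with ho | ⟨hs, hu⟩
    · have : ∑ e ∈ H.incidenceFinset v, f e = 1 := by
        rw [hloc v C hC hv _ (hfodd C hC ho)]
        obtain ⟨a, b, hab, h⟩ := oddCycle_nbrs _ ho ⟨v, hv⟩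
        have hab' : (a : V) ≠ b := fun h => hab (Subtype.ext h)
        have h2 : Finset.univ.filter (fun w => C.Adj v w) = {(a : V), (b : V)} := by
          ext w
          simp only [Finset.mem_filter, Finset.mem_univ, true_and, Finset.mem_insert,
            Finset.mem_singleton]
          constructor
          · intro hw
            have := (h ⟨w, C.edge_vert hw.symm⟩).mp hw
            simpa [Subtype.ext_iff] using this
          · rintro (rfl | rfl)
            · exact (h a).mpr (Or.inl rfl)
            · exact (h b).mpr (Or.inr rfl)
        rw [← Finset.sum_filter, h2, Finset.sum_pair hab']
        norm_num
      exact ⟨this.ge, fun _ => this⟩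
    · rw [hloc v C hC hv _ (hfstar C hC hs)]
      obtain ⟨w, hw⟩ := star_nbr _ hs ⟨v, hv⟩
      have hw : C.Adj v w := hw
      constructor
      · have := Finset.single_le_sum (f := fun w => if C.Adj v w then (1 : ℝ) else 0)
          (fun i _ => by split_ifs <;> norm_num) (Finset.mem_univ (w : V))
        simpa only [if_pos hw] using this
      · intro hyv
        rw [Finset.sum_eq_single (w : V), if_pos hw]
        · intro b _ hb
          exact if_neg fun h => hb (hu v hyv _ _ h hw)
        · intro h; exact absurd (Finset.mem_univ _) h
  have hcov : IsFracEdgeCover H f := by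
    refine ⟨hf0, ?_, fun v => (hdeg v).1⟩
    intro e he
    exact hfz e fun C _ h => he (C.edgeSet_subset h)
  -- weak duality
  have hweak : ∀ g, IsFracEdgeCover H g → ∑ v, y v ≤ coverCost H g := by
    intro g hg
    calc ∑ v, y v ≤ ∑ v, y v * ∑ e ∈ H.incidenceFinset v, g e :=
          Finset.sum_le_sum fun v _ => le_mul_of_one_le_right (hy0 v) (hg.2.2 v)
      _ = ∑ e ∈ H.edgeFinset, g e * ∑ v, if v ∈ e then y v else 0 := sum_double H g y
      _ ≤ ∑ e ∈ H.edgeFinset, g e := by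
          refine Finset.sum_le_sum fun e he => mul_le_of_le_one_right (hg.1 e) ?_
          induction e using Sym2.ind with
          | _ a b =>
            have hab : H.Adj a b := by simpa using he
            rw [sum_mem_pair y hab.ne]
            exact hy1 a b hab
  have hstrong : coverCost H f = ∑ v, y v := by
    have h1 : ∑ v, y v = ∑ v, y v * ∑ e ∈ H.incidenceFinset v, f e := by
      refine Finset.sum_congr rfl fun v _ => ?_
      by_cases h : y v = 0
      · rw [h, zero_mul]
      · rw [(hdeg v).2 h, mul_one]
    rw [h1, sum_double H f y]
    refine Finset.sum_congr rfl fun e he => ?_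
    by_cases h : ∃ C ∈ S, e ∈ C.edgeSet
    · obtain ⟨C, hC, heC⟩ := h
      induction e using Sym2.ind with
      | _ a b =>
        have hab : C.Adj a b := heC
        rw [sum_mem_pair y hab.ne, hyC C hC a b hab, mul_one]
    · rw [hfz e fun C hC he => h ⟨C, hC, he⟩, zero_mul]
  refine ⟨f, D, hcov, ?_, ?_, ?_, ?_⟩
  · apply le_antisymm
    · refine le_csInf ⟨_, f, hcov, rfl⟩ ?_
      rintro _ ⟨g, hg, rfl⟩
      rw [hstrong]; exact hweak g hg
    · refine csInf_le ⟨∑ v, y v, ?_⟩ ⟨f, hcov, rfl⟩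
      rintro _ ⟨g, hg, rfl⟩
      exact hweak g hg
  · exact fun i ho e he => hfodd _ (E.symm i).2 ho e he
  · exact fun i ho e he => hfstar _ (E.symm i).2 ho e he
  · intro e _ h
    refine hfz e fun C hC he => h (E ⟨C, hC⟩) ?_
    simpa [D] using he
end

section
/- For every odd integer k ≥ 3 there exists a constant c = c(k) such that the following holds: if G is a finite simple graph whose edge set is the union of α ≥ 1 acyclic spanning subgraphs (forests), then the number N_k of rooted directed k-cycles of G satisfies N_k ≤ c · α · m^{(k−1)/2}; equivalently (up to the constant), a graph of arboricity at most α contains at most c · α · m^{(k−1)/2} k-cycle subgraphs. -/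
/-- An acyclic graph has a parent function. -/
theorem exists_parent_of_isAcyclic {V : Type*} (H : SimpleGraph V) (hH : H.IsAcyclic) :
    ∃ p : V → V, ∀ u v, H.Adj u v → p u = v ∨ p v = u := by
  classical
  have hr : ∀ v : V, ∃ q : H.Walk v (H.connectedComponentMk v).out, q.IsPath := by
    intro v
    have : H.Reachable v (H.connectedComponentMk v).out := by
      rw [← SimpleGraph.ConnectedComponent.eq]
      exact (Quot.out_eq _).symm
    exact this.exists_isPath
  choose q hq using hr
  refine ⟨fun v => (q v).snd, fun u v h => ?_⟩
  have hc : H.connectedComponentMk u = H.connectedComponentMk v :=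
    SimpleGraph.ConnectedComponent.eq.2 h.reachable
  have key : ∀ (t : V) (P : H.Walk u t) (Q : H.Walk v t), P.IsPath → Q.IsPath →
      P.snd = v ∨ Q.snd = u := by
    intro t P Q hP hQ
    by_cases hu : u ∈ Q.support
    · right
      have h1 : (Q.takeUntil u hu).IsPath := hQ.takeUntil hu
      have h2 : (SimpleGraph.Walk.cons h.symm SimpleGraph.Walk.nil).IsPath := by
        simp [h.ne']
      have h3 := congrArg Subtype.val (hH.path_unique ⟨_, h1⟩ ⟨_, h2⟩)
      simp only at h3
      have h4 := Q.take_spec hu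
      rw [← h4, h3]
      simp
    · left
      have h1 : (SimpleGraph.Walk.cons h Q).IsPath := hQ.cons hu
      have h3 := congrArg Subtype.val (hH.path_unique ⟨_, h1⟩ ⟨_, hP⟩)
      simp only at h3
      rw [← h3]
      simp
  have hk := key _ (q u) ((q v).copy rfl (by rw [hc])) (hq u) (by simpa using hq v)
  simpa [SimpleGraph.Walk.snd, SimpleGraph.Walk.getVert_copy] using hk

/-- For every odd integer `k ≥ 3` there is a constant `c = c(k) > 0` such
that if the edge set of a finite simple graph `G` is the union of `α ≥ 1` forests, then the
number `N_k` of rooted directed `k`-cycles of `G` satisfies `N_k ≤ c · α · m^((k−1)/2)`,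
where `m = Σ_v d(v)` is the number of oriented edges of `G`. -/
theorem rootedCycleCount_le_of_arboricity (k : ℕ) (hodd : Odd k) (hk : 3 ≤ k) :
    ∃ c : ℕ, 0 < c ∧
      ∀ (V : Type*) [Fintype V] (G : SimpleGraph V) [DecidableRel G.Adj] (α : ℕ),
        1 ≤ α →
        (∃ F : Fin α → G.Subgraph,
            (∀ i, (F i).coe.IsAcyclic) ∧ ∀ e ∈ G.edgeSet, ∃ i, e ∈ (F i).edgeSet) →
        rootedCycleCount G k ≤ c * α * (∑ v : V, G.degree v) ^ ((k - 1) / 2) := by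
  refine ⟨2, by norm_num, ?_⟩
  rintro V _ G _ α - ⟨F, hF, hcov⟩
  classical
  obtain ⟨r, rfl⟩ := hodd
  have hr : (2 * r + 1 - 1) / 2 = r := by omega
  rw [hr]
  have hpar : ∀ i, ∃ p : V → V, ∀ u v, (F i).Adj u v → p u = v ∨ p v = u := by
    intro i
    obtain ⟨p, hp⟩ := exists_parent_of_isAcyclic _ (hF i)
    refine ⟨fun v => if h : v ∈ (F i).verts then p ⟨v, h⟩ else v, fun u v h => ?_⟩
    have hu := (F i).edge_vert h
    have hv := (F i).edge_vert h.symm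
    have := hp ⟨u, hu⟩ ⟨v, hv⟩ h
    simpa [hu, hv, Subtype.ext_iff] using this
  choose p hp using hpar
  have hchoice : ∀ x : (v : V) × {w : G.Walk v v // w.length = 2 * r + 1 ∧ w.IsCycle},
      ∃ (b : Bool) (i : Fin α),
        (b = true → p i (x.2.1.getVert 0) = x.2.1.getVert 1) ∧
        (b = false → p i (x.2.1.getVert 1) = x.2.1.getVert 0) := by
    rintro ⟨v, w, hw, hc⟩
    have hadj : G.Adj (w.getVert 0) (w.getVert 1) :=
      w.adj_getVert_succ (i := 0) (by omega)
    obtain ⟨i, hi⟩ := hcov s(w.getVert 0, w.getVert 1) hadj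
    rcases hp i _ _ hi with h | h
    · exact ⟨true, i, fun _ => h, by simp⟩
    · exact ⟨false, i, by simp, fun _ => h⟩
  choose b i hb1 hb2 using hchoice
  let d : ((v : V) × {w : G.Walk v v // w.length = 2 * r + 1 ∧ w.IsCycle}) →
      Fin r → G.Dart := fun x j =>
    ⟨(x.2.1.getVert (2 * j + 1 + (b x).toNat), x.2.1.getVert (2 * j + 1 + (b x).toNat + 1)),
      x.2.1.adj_getVert_succ (by
        have h1 := x.2.2.1
        have h2 := j.2
        have h3 := Bool.toNat_le (b x)
        omega)⟩
  have hinj : Function.Injective (fun x => (b x, i x, d x)) := by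
    intro x y hxy
    simp only [Prod.mk.injEq] at hxy
    obtain ⟨hb, hi, hd⟩ := hxy
    -- all inner vertices agree
    have hin : ∀ n, n < 2 * r → x.2.1.getVert (n + 1 + (b x).toNat)
        = y.2.1.getVert (n + 1 + (b x).toNat) := by
      intro n hn
      have h := congrArg SimpleGraph.Dart.toProd (congrFun hd ⟨n / 2, by omega⟩)
      simp only [d, Prod.mk.injEq, ← hb] at h
      rcases Nat.mod_two_eq_zero_or_one n with h0 | h0
      · have : 2 * (n / 2) = n := by omega
        rw [this] at h
        exact h.1
      · have e : 2 * (n / 2) + 1 + (b x).toNat + 1 = n + 1 + (b x).toNat := by omega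
        rw [e] at h
        exact h.2
    have hx0 : x.2.1.getVert (2 * r + 1) = x.2.1.getVert 0 := by
      have := x.2.1.getVert_length
      rw [x.2.2.1] at this
      simp [this]
    have hy0 : y.2.1.getVert (2 * r + 1) = y.2.1.getVert 0 := by
      have := y.2.1.getVert_length
      rw [y.2.2.1] at this
      simp [this]
    have hall : ∀ n, n ≤ 2 * r + 1 → x.2.1.getVert n = y.2.1.getVert n := by
      cases hbx : b x with
      | true =>
        have hby : b y = true := hb ▸ hbx
        simp only [hbx, Bool.toNat_true] at hin
        have e1 : x.2.1.getVert (2 * r + 1) = y.2.1.getVert (2 * r + 1) := by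
          have := hin (2 * r - 1) (by omega)
          rwa [show 2 * r - 1 + 1 + 1 = 2 * r + 1 by omega] at this
        have e0 : x.2.1.getVert 0 = y.2.1.getVert 0 := by rw [← hx0, ← hy0, e1]
        intro n hn
        match n with
        | 0 => exact e0
        | 1 => rw [← hb1 x hbx, ← hb1 y hby, e0, hi]
        | n + 2 => exact hin n (by omega)
      | false =>
        have hby : b y = false := hb ▸ hbx
        simp only [hbx, Bool.toNat_false, Nat.add_zero] at hin
        have e1 : x.2.1.getVert 1 = y.2.1.getVert 1 := hin 0 (by omega)
        have e0 : x.2.1.getVert 0 = y.2.1.getVert 0 := by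
          rw [← hb2 x hbx, ← hb2 y hby, e1, hi]
        intro n hn
        match n with
        | 0 => exact e0
        | n + 1 =>
          rcases Nat.lt_or_ge n (2 * r) with h | h
          · exact hin n h
          · obtain rfl : n = 2 * r := by omega
            rw [hx0, hy0, e0]
    obtain ⟨v, w, hw, hwc⟩ := x
    obtain ⟨v', w', hw', hwc'⟩ := y
    have hv : v = v' := by simpa using hall 0 (by omega)
    subst hv
    have : w = w' := by
      apply SimpleGraph.Walk.ext_getVert_le_length (hw.trans hw'.symm)
      intro n hn
      exact hall n (hw ▸ hn)
    subst this
    rfl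
  have hcard := Nat.card_le_card_of_injective _ hinj
  rw [rootedCycleCount]
  refine hcard.trans (le_of_eq ?_)
  rw [Nat.card_eq_fintype_card]
  simp [SimpleGraph.dart_card_eq_sum_degrees, mul_assoc, -SimpleGraph.sum_degrees_eq_twice_card_edges]
end

section
/- Let G be a finite simple graph on n vertices with m ≥ 2 oriented edges. Let k_1,…,k_q be odd integers, each at least 3, and let p_1,…,p_ℓ be integers, each at least 1, with q + ℓ ≥ 1. For each i, let o_{k_i} denote the number of rooted directed k_i-cycles of G, and for each j let s_{p_j} = Σ_{v∈V} C(d(v), p_j); assume all of these counts are positive. Define the sampling costs cost(O_k) = m^{k/2}/o_k for each odd cycle and cost(S_p) = min{ m · n^{p−1}/s_p , m / s_p^{1/p} } for each star (with real exponents). Then (max over all q + ℓ components of cost(C_i)) · Π_{i=1}^q o_{k_i} · Π_{j=1}^ℓ s_{p_j} ≤ m^{Σ_{i=1}^q k_i/2 + Σ_{j=1}^ℓ p_j}; that is, the decomposition cost of any decomposition D with these components is at most m^{ρ(D)} divided by the number of copies of the motif. -/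
attribute [local instance] Matrix.frobeniusNormedAddCommGroup Matrix.frobeniusNormedRing

lemma trace_pow_le_aux {V : Type*} [Fintype V] [DecidableEq V] (A : Matrix V V ℝ) (m : ℝ)
    (hm : ∑ i, ∑ j, A i j ^ 2 = m) (k : ℕ) (hk : 1 ≤ k) :
    (A ^ (k + 1)).trace ≤ m ^ (((k + 1 : ℕ) : ℝ) / 2) := by
  have hnorm : ∀ B : Matrix V V ℝ, ‖B‖ = √(∑ i, ∑ j, B i j ^ 2) := by
    intro B
    rw [Matrix.frobenius_norm_def, Real.sqrt_eq_rpow]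
    simp
  have hm0 : 0 ≤ m := by rw [← hm]; positivity
  have hA : ‖A‖ = m ^ ((1 : ℝ) / 2) := by rw [hnorm, hm, Real.sqrt_eq_rpow]
  have hcs : ∀ B C : Matrix V V ℝ, (B * C).trace ≤ ‖B‖ * ‖C‖ := by
    intro B C
    have h := Real.sum_mul_le_sqrt_mul_sqrt (Finset.univ : Finset (V × V))
      (fun x => B x.1 x.2) (fun x => C x.2 x.1)
    simp only [Fintype.sum_prod_type] at h
    rw [hnorm B, hnorm C, Finset.sum_comm (f := fun i j => C i j ^ 2)]
    simpa [Matrix.trace, Matrix.mul_apply] using h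
  calc (A ^ (k + 1)).trace = (A ^ k * A).trace := by rw [pow_succ]
    _ ≤ ‖A ^ k‖ * ‖A‖ := hcs _ _
    _ ≤ ‖A‖ ^ k * ‖A‖ := by
        gcongr
        exact norm_pow_le' A hk
    _ = ‖A‖ ^ (k + 1) := (pow_succ _ _).symm
    _ = _ := by
        rw [hA, ← Real.rpow_natCast, ← Real.rpow_mul hm0]
        congr 1
        ring

lemma rootedCycleCount_le_aux {V : Type*} [Fintype V] (G : SimpleGraph V) [DecidableRel G.Adj]
    (k : ℕ) (hk : 2 ≤ k) :
    (rootedCycleCount G k : ℝ) ≤ ((∑ v : V, G.degree v : ℕ) : ℝ) ^ ((k : ℝ) / 2) := by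
  classical
  have h1 : rootedCycleCount G k ≤
      Fintype.card ((v : V) × {w : G.Walk v v // w.length = k}) := by
    rw [← Nat.card_eq_fintype_card]
    unfold rootedCycleCount
    refine Nat.card_le_card_of_injective
      (fun x => ⟨x.1, ⟨x.2.1, x.2.2.1⟩⟩) ?_
    rintro ⟨v, w, hw⟩ ⟨v', w', hw'⟩ h
    simp only [Sigma.mk.injEq] at h
    obtain ⟨rfl, h⟩ := h
    simpa using h
  have h2 : ((Fintype.card ((v : V) × {w : G.Walk v v // w.length = k}) : ℕ) : ℝ)
      = ((G.adjMatrix ℝ) ^ k).trace := by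
    rw [Fintype.card_sigma, Matrix.trace]
    push_cast
    refine Finset.sum_congr rfl fun v _ => ?_
    rw [Matrix.diag_apply, SimpleGraph.adjMatrix_pow_apply_eq_card_walk]
    norm_cast
  have h3 : ∑ i, ∑ j, (G.adjMatrix ℝ) i j ^ 2 = ((∑ v : V, G.degree v : ℕ) : ℝ) := by
    push_cast
    refine Finset.sum_congr rfl fun v _ => ?_
    simp [SimpleGraph.adjMatrix_apply, ite_pow, ← SimpleGraph.card_neighborFinset_eq_degree,
      SimpleGraph.neighborFinset_eq_filter]
  obtain ⟨j, rfl⟩ : ∃ j, k = j + 1 := ⟨k - 1, by omega⟩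
  calc (rootedCycleCount G (j + 1) : ℝ) ≤ _ := by exact_mod_cast h1
    _ = _ := h2
    _ ≤ _ := trace_pow_le_aux _ _ h3 j (by omega)

lemma star_le_aux {V : Type*} [Fintype V] (d : V → ℕ) (p : ℕ) (hp : 1 ≤ p) :
    ∑ v, (d v).choose p ≤ (∑ v, d v) ^ p := by
  calc ∑ v, (d v).choose p ≤ ∑ v, d v * (∑ u, d u) ^ (p - 1) := by
        refine Finset.sum_le_sum fun v _ => ?_
        calc (d v).choose p ≤ d v ^ p := Nat.choose_le_pow _ _
          _ = d v * d v ^ (p - 1) := by rw [← pow_succ', Nat.sub_add_cancel hp]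
          _ ≤ _ := by
            gcongr
            exact Finset.single_le_sum (f := d) (fun _ _ => Nat.zero_le _) (Finset.mem_univ v)
    _ = _ := by rw [← Finset.sum_mul, ← pow_succ', Nat.sub_add_cancel hp]

lemma star_cost_aux (m s : ℝ) (p : ℕ) (hp : 1 ≤ p) (hm : 0 < m) (hs : 0 < s)
    (h : s ≤ m ^ (p : ℝ)) : m / s ^ (1 / (p : ℝ)) * s ≤ m ^ (p : ℝ) := by
  have hp' : (1 : ℝ) ≤ p := by exact_mod_cast hp
  have e : m / s ^ (1 / (p : ℝ)) * s = m * s ^ (1 - 1 / (p : ℝ)) := by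
    rw [Real.rpow_sub hs, Real.rpow_one]; ring
  have hnn : 0 ≤ 1 - 1 / (p : ℝ) := by
    rw [sub_nonneg, div_le_one (by linarith)]; exact hp'
  rw [e]
  calc m * s ^ (1 - 1 / (p : ℝ)) ≤ m * (m ^ (p : ℝ)) ^ (1 - 1 / (p : ℝ)) := by gcongr
    _ = m ^ (1 : ℝ) * m ^ ((p : ℝ) - 1) := by
        rw [← Real.rpow_mul hm.le, Real.rpow_one]
        congr 2
        field_simp
    _ = _ := by rw [← Real.rpow_add hm]; congr 1; ring

lemma prod_aux {ι : Type*} [Fintype ι] (c M f : ι → ℝ) (hc : ∀ i, 0 ≤ c i)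
    (hcM : ∀ i, c i ≤ M i) (hf : ∀ i, f i * c i ≤ M i) (i : ι) :
    f i * ∏ x, c x ≤ ∏ x, M x := by
  classical
  rw [← Finset.mul_prod_erase _ c (Finset.mem_univ i),
    ← Finset.mul_prod_erase _ M (Finset.mem_univ i), ← mul_assoc]
  exact mul_le_mul (hf i) (Finset.prod_le_prod (fun j _ => hc j) (fun j _ => hcM j))
    (Finset.prod_nonneg fun j _ => hc j) ((hc i).trans (hcM i))

/-- Let `G` be a graph on `n` vertices with `m ≥ 2` oriented edges, let
`k_1,…,k_q` be odd integers `≥ 3` and `p_1,…,p_ℓ` integers `≥ 1` with `q + ℓ ≥ 1`. With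
`o_{k_i}` the (positive) number of rooted directed `k_i`-cycles, `s_{p_j}` the (positive)
`p_j`-star counts, `cost(O_k) = m^(k/2)/o_k` and
`cost(S_p) = min(m·n^(p−1)/s_p, m/s_p^(1/p))` (real exponents), the maximum component cost
times the product of all component counts is at most `m^(Σ k_i/2 + Σ p_j)`. -/
theorem decompCost_le {V : Type*} [Fintype V] (G : SimpleGraph V) [DecidableRel G.Adj]
    (q ℓ : ℕ) (hql : 1 ≤ q + ℓ)
    (k : Fin q → ℕ) (hodd : ∀ i, Odd (k i)) (hk3 : ∀ i, 3 ≤ k i)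
    (p : Fin ℓ → ℕ) (hp : ∀ j, 1 ≤ p j)
    (hm : 2 ≤ ∑ v : V, G.degree v)
    (ho : ∀ i, 0 < rootedCycleCount G (k i))
    (hs : ∀ j, 0 < ∑ v : V, (G.degree v).choose (p j))
    (hne : (Finset.univ : Finset (Fin q ⊕ Fin ℓ)).Nonempty) :
    Finset.univ.sup' hne
        (Sum.elim
          (fun i =>
            ((∑ v : V, G.degree v : ℕ) : ℝ) ^ ((k i : ℝ) / 2) /
              (rootedCycleCount G (k i) : ℝ))
          (fun j =>
            min
              (((∑ v : V, G.degree v : ℕ) : ℝ) *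
                  (Fintype.card V : ℝ) ^ ((p j : ℝ) - 1) /
                ((∑ v : V, (G.degree v).choose (p j) : ℕ) : ℝ))
              (((∑ v : V, G.degree v : ℕ) : ℝ) /
                ((∑ v : V, (G.degree v).choose (p j) : ℕ) : ℝ) ^ (1 / (p j : ℝ))))) *
        ((∏ i, (rootedCycleCount G (k i) : ℝ)) *
          ∏ j, ((∑ v : V, (G.degree v).choose (p j) : ℕ) : ℝ)) ≤
      ((∑ v : V, G.degree v : ℕ) : ℝ) ^ ((∑ i, (k i : ℝ) / 2) + ∑ j, (p j : ℝ)) := by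
  have hm0 : (0 : ℝ) < ((∑ v : V, G.degree v : ℕ) : ℝ) := by
    exact_mod_cast (by omega : 0 < ∑ v : V, G.degree v)
  have hcyc := fun i => rootedCycleCount_le_aux G (k i) (by have := hk3 i; omega)
  have hstar : ∀ j, ((∑ v : V, (G.degree v).choose (p j) : ℕ) : ℝ) ≤
      ((∑ v : V, G.degree v : ℕ) : ℝ) ^ (p j : ℝ) := by
    intro j
    rw [Real.rpow_natCast]
    exact_mod_cast star_le_aux (fun v => G.degree v) (p j) (hp j)
  generalize ((∑ v : V, G.degree v : ℕ) : ℝ) = m at *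
  obtain ⟨x, -, hx⟩ := Finset.exists_mem_eq_sup' hne
        (Sum.elim
          (fun i => m ^ ((k i : ℝ) / 2) / (rootedCycleCount G (k i) : ℝ))
          (fun j =>
            min
              (m * (Fintype.card V : ℝ) ^ ((p j : ℝ) - 1) /
                ((∑ v : V, (G.degree v).choose (p j) : ℕ) : ℝ))
              (m / ((∑ v : V, (G.degree v).choose (p j) : ℕ) : ℝ) ^ (1 / (p j : ℝ)))))
  rw [hx]
  have key := prod_aux
    (Sum.elim (fun i => (rootedCycleCount G (k i) : ℝ))
      (fun j => ((∑ v : V, (G.degree v).choose (p j) : ℕ) : ℝ)))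
    (Sum.elim (fun i => m ^ ((k i : ℝ) / 2)) (fun j => m ^ (p j : ℝ)))
        (Sum.elim
          (fun i => m ^ ((k i : ℝ) / 2) / (rootedCycleCount G (k i) : ℝ))
          (fun j =>
            min
              (m * (Fintype.card V : ℝ) ^ ((p j : ℝ) - 1) /
                ((∑ v : V, (G.degree v).choose (p j) : ℕ) : ℝ))
              (m / ((∑ v : V, (G.degree v).choose (p j) : ℕ) : ℝ) ^ (1 / (p j : ℝ)))))
    ?_ ?_ ?_ x
  · rw [Fintype.prod_sum_type, Fintype.prod_sum_type] at key
    simp only [Sum.elim_inl, Sum.elim_inr] at key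
    rw [Real.rpow_add hm0, Real.rpow_sum_of_pos hm0, Real.rpow_sum_of_pos hm0]
    exact key
  · rintro (i | j)
    · exact Nat.cast_nonneg _
    · exact Nat.cast_nonneg _
  · rintro (i | j)
    · exact hcyc i
    · exact hstar j
  · rintro (i | j)
    · have h : (0 : ℝ) < (rootedCycleCount G (k i) : ℝ) := by exact_mod_cast ho i
      simp only [Sum.elim_inl]
      rw [div_mul_cancel₀ _ h.ne']
    · have h : (0 : ℝ) < ((∑ v : V, (G.degree v).choose (p j) : ℕ) : ℝ) := by
        exact_mod_cast hs j
      simp only [Sum.elim_inr]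
      refine le_trans (mul_le_mul_of_nonneg_right (min_le_right _ _) h.le) ?_
      exact star_cost_aux m _ (p j) (hp j) hm0 h (hstar j)
end
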